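/- arXiv:2103.09117 — 4 statements merged into one kernel-verified Lean document; each statement's English description precedes it below -/
import Mathlib

section
/- Suppose f is holomorphic on the strip Ω_{a,b} = {x - it : x ∈ ℝ, t ∈ (a,b)}, of exponential type (|f(x-it)| ≤ C(t) e^{s|x|} with C locally bounded), and f is Lebesgue integrable on the lines ℝ - it₁ and ℝ - it₂ where a < t₁ < t₂ < b. Then for every t ∈ [t₁, t₂], f is Lebesgue integrable on the line ℝ - it, and the function t ↦ log ‖f(· - it)‖_{L¹} is convex on [t₁, t₂]. -/
open Complex Set MeasureTheory

/-- Phragmén–Lindelöf principle for functions of exponential type in a closed horizontal strip. -/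
theorem norm_le_of_exp_growth_of_horizontal_strip {F : ℂ → ℂ} {y₁ y₂ s M K : ℝ} (hy : y₁ < y₂)
    (hF : DifferentiableOn ℂ F (im ⁻¹' Icc y₁ y₂)) (hs : 0 ≤ s)
    (hM : ∀ z : ℂ, z.im ∈ Icc y₁ y₂ → ‖F z‖ ≤ M * Real.exp (s * |z.re|))
    (h₁ : ∀ z : ℂ, z.im = y₁ → ‖F z‖ ≤ K) (h₂ : ∀ z : ℂ, z.im = y₂ → ‖F z‖ ≤ K)
    {z : ℂ} (hz : z.im ∈ Icc y₁ y₂) : ‖F z‖ ≤ K := by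
  have hd : DiffContOnCl ℂ F (im ⁻¹' Ioo y₁ y₂) := by
    apply DifferentiableOn.diffContOnCl
    rw [Complex.closure_preimage_im, closure_Ioo hy.ne]
    exact hF
  have hc : 0 < Real.pi / (2 * (y₂ - y₁)) := by
    have := sub_pos.2 hy
    positivity
  refine PhragmenLindelof.horizontal_strip hd
    ⟨Real.pi / (2 * (y₂ - y₁)), ?_, s / (Real.pi / (2 * (y₂ - y₁))), ?_⟩ h₁ h₂ hz.1 hz.2
  · have := sub_pos.2 hy
    rw [← div_div, div_right_comm]
    exact half_lt_self (by positivity)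
  · refine Asymptotics.IsBigO.of_bound |M| ?_
    filter_upwards [Filter.mem_inf_of_right (Filter.mem_principal_self _)] with w hw
    refine (hM w ⟨hw.1.le, hw.2.le⟩).trans ?_
    rw [Real.norm_of_nonneg (Real.exp_pos _).le]
    refine mul_le_mul (le_abs_self M) (Real.exp_le_exp.2 ?_) (Real.exp_pos _).le (abs_nonneg M)
    set c := Real.pi / (2 * (y₂ - y₁))
    have h : c * |w.re| ≤ Real.exp (c * |w.re|) := by
      linarith [Real.add_one_le_exp (c * |w.re|)]
    calc s * |w.re| = s / c * (c * |w.re|) := by field_simp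
      _ ≤ _ := by gcongr

theorem differentiableAt_setIntegral_mul_translate {g : ℂ → ℂ} {U : Set ℂ} (hU : IsOpen U)
    (hg : DifferentiableOn ℂ g U) {φ : ℝ → ℂ} (hφ : Measurable φ) (hφ1 : ∀ u, ‖φ u‖ ≤ 1)
    {S : Set ℝ} (hS : IsCompact S) {z : ℂ} (hz : ∀ u ∈ S, z + u ∈ U) :
    DifferentiableAt ℂ (fun w : ℂ => ∫ u in S, φ u * g (w + u)) z := by
  have hK : IsCompact ((fun u : ℝ => z + u) '' S) := hS.image (by fun_prop)
  have hKU : (fun u : ℝ => z + u) '' S ⊆ U := by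
    rintro _ ⟨u, hu, rfl⟩
    exact hz u hu
  obtain ⟨r, hr, hrU⟩ := hK.exists_cthickening_subset_open hU hKU
  have hmem : ∀ w ∈ Metric.ball z r, ∀ u ∈ S,
      w + u ∈ Metric.cthickening r ((fun u : ℝ => z + u) '' S) := by
    intro w hw u hu
    refine Metric.mem_cthickening_of_dist_le _ _ _ _ ⟨u, hu, rfl⟩ ?_
    simpa using (Metric.mem_ball.1 hw).le
  have hdg : ContinuousOn (deriv g) U := (hg.deriv hU).continuousOn
  obtain ⟨B, hB⟩ := hK.cthickening.exists_bound_of_continuousOn (hdg.mono hrU)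
  have hmeas : ∀ {h : ℂ → ℂ}, ContinuousOn h U → ∀ w ∈ Metric.ball z r,
      AEStronglyMeasurable (fun u : ℝ => φ u * h (w + u)) (volume.restrict S) := by
    intro h hh w hw
    refine hφ.aestronglyMeasurable.mul (ContinuousOn.aestronglyMeasurable ?_ hS.measurableSet)
    exact hh.comp (by fun_prop) fun u hu => hrU (hmem w hw u hu)
  have hzr : z ∈ Metric.ball z r := Metric.mem_ball_self hr
  have hfin : IsFiniteMeasure (volume.restrict S) := ⟨by simpa using hS.measure_lt_top⟩
  have hint : Integrable (fun u : ℝ => φ u * g (z + u)) (volume.restrict S) := by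
    obtain ⟨D, hD⟩ := hK.exists_bound_of_continuousOn (hg.continuousOn.mono hKU)
    refine Integrable.of_bound (hmeas hg.continuousOn z hzr) D ?_
    refine (ae_restrict_iff' hS.measurableSet).2 (.of_forall fun u hu => ?_)
    rw [norm_mul]
    exact (mul_le_of_le_one_left (norm_nonneg _) (hφ1 u)).trans (hD _ ⟨u, hu, rfl⟩)
  refine (hasDerivAt_integral_of_dominated_loc_of_deriv_le (bound := fun _ => B)
    (F' := fun w u => φ u * deriv g (w + u)) (Metric.ball_mem_nhds z hr) ?_ hint
    (hmeas hdg z hzr) ?_ (integrable_const B) ?_).2.differentiableAt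
  · filter_upwards [Metric.ball_mem_nhds z hr] with w hw using hmeas hg.continuousOn w hw
  · refine (ae_restrict_iff' hS.measurableSet).2 (.of_forall fun u hu w hw => ?_)
    rw [norm_mul]
    exact (mul_le_of_le_one_left (norm_nonneg _) (hφ1 u)).trans (hB _ (hmem w hw u hu))
  · refine (ae_restrict_iff' hS.measurableSet).2 (.of_forall fun u hu w hw => ?_)
    have := (hg.differentiableAt (hU.mem_nhds (hrU (hmem w hw u hu)))).hasDerivAt
    exact (this.comp_add_const w (u : ℂ)).const_mul (φ u)

/-- Uniform `L¹` bound on segments of intermediate lines of a horizontal strip. -/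
theorem setIntegral_norm_le_of_horizontal_strip {g : ℂ → ℂ} {U : Set ℂ} {y₁ y₂ s M K N : ℝ}
    (hy : y₁ < y₂) (hU : IsOpen U) (hsub : im ⁻¹' Icc y₁ y₂ ⊆ U) (hg : DifferentiableOn ℂ g U)
    (hs : 0 ≤ s) (hM : ∀ z : ℂ, z.im ∈ Icc y₁ y₂ → ‖g z‖ ≤ M * Real.exp (s * |z.re|))
    (hi₁ : Integrable (fun x : ℝ => g (x + y₁ * I)))
    (hi₂ : Integrable (fun x : ℝ => g (x + y₂ * I)))
    (h₁ : ∫ x : ℝ, ‖g (x + y₁ * I)‖ ≤ K) (h₂ : ∫ x : ℝ, ‖g (x + y₂ * I)‖ ≤ K)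
    {y : ℝ} (hyy : y ∈ Icc y₁ y₂) : ∫ x in Icc (-N) N, ‖g (x + y * I)‖ ≤ K := by
  have hcont : ∀ w : ℂ, w.im ∈ Icc y₁ y₂ → Continuous (fun u : ℝ => g (w + u)) := by
    intro w hw
    refine hg.continuousOn.comp_continuous (by fun_prop) fun u => hsub ?_
    simpa using hw
  set φ : ℝ → ℂ := fun u => (‖g (y * I + u)‖ : ℂ) / g (y * I + u) with hφ
  have hcy : Continuous (fun u : ℝ => g (y * I + u)) := hcont _ (by simpa using hyy)
  have hφm : Measurable φ := by
    have h := hcy.measurable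
    exact (Complex.measurable_ofReal.comp h.norm).div h
  have hφ1 : ∀ u, ‖φ u‖ ≤ 1 := by
    intro u
    simp only [hφ, norm_div, norm_real, norm_norm]
    exact div_self_le_one _
  set F : ℂ → ℂ := fun w => ∫ u in Icc (-N) N, φ u * g (w + u) with hF
  have hFle : ∀ w : ℂ, w.im ∈ Icc y₁ y₂ → ‖F w‖ ≤ ∫ u in Icc (-N) N, ‖g (w + u)‖ := by
    intro w hw
    refine norm_integral_le_of_norm_le ((hcont w hw).norm.integrableOn_Icc) (.of_forall fun u => ?_)
    rw [norm_mul]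
    exact mul_le_of_le_one_left (norm_nonneg _) (hφ1 u)
  have hedge : ∀ η ∈ Icc y₁ y₂, Integrable (fun x : ℝ => g (x + η * I)) →
      ∫ x : ℝ, ‖g (x + η * I)‖ ≤ K → ∀ w : ℂ, w.im = η → ‖F w‖ ≤ K := by
    intro η hη hi hle w hw
    have hshift : (fun u : ℝ => ‖g (w + u)‖) =
        fun u : ℝ => (fun x : ℝ => ‖g (x + η * I)‖) (w.re + u) := by
      ext u
      congr 2
      apply Complex.ext <;> simp [hw]
    refine (hFle w (hw ▸ hη)).trans (le_trans ?_ hle)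
    rw [← integral_add_left_eq_self (fun x : ℝ => ‖g (x + η * I)‖) w.re, hshift]
    exact setIntegral_le_integral (hi.norm.comp_add_left w.re) (.of_forall fun u => norm_nonneg _)
  have hFd : DifferentiableOn ℂ F (im ⁻¹' Icc y₁ y₂) := fun w hw =>
    (differentiableAt_setIntegral_mul_translate hU hg hφm hφ1 isCompact_Icc
      fun u _ => hsub (by simpa using hw)).differentiableWithinAt
  have hM0 : 0 ≤ M := by
    have h := (norm_nonneg _).trans (hM (y * I) (by simpa using hyy))
    simpa using h
  have hFM : ∀ w : ℂ, w.im ∈ Icc y₁ y₂ →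
      ‖F w‖ ≤ (M * Real.exp (s * N) * volume.real (Icc (-N) N)) * Real.exp (s * |w.re|) := by
    intro w hw
    refine (norm_setIntegral_le_of_norm_le_const
      (C := M * Real.exp (s * N) * Real.exp (s * |w.re|)) isCompact_Icc.measure_lt_top ?_).trans
      (le_of_eq (by ring))
    intro u hu
    rw [norm_mul]
    refine (mul_le_of_le_one_left (norm_nonneg _) (hφ1 u)).trans
      ((hM _ (by simpa using hw)).trans ?_)
    rw [mul_assoc, ← Real.exp_add, ← mul_add]
    have : |(w + u).re| ≤ N + |w.re| := by
      have h := abs_add_le w.re u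
      have h' := abs_le.2 hu
      simp only [add_re, ofReal_re]
      linarith
    gcongr
  have key := norm_le_of_exp_growth_of_horizontal_strip hy hFd hs hFM
    (hedge y₁ (left_mem_Icc.2 hy.le) hi₁ h₁) (hedge y₂ (right_mem_Icc.2 hy.le) hi₂ h₂)
    (z := y * I) (by simpa using hyy)
  have hFy : F (y * I) = ((∫ x in Icc (-N) N, ‖g (x + y * I)‖ : ℝ) : ℂ) := by
    rw [← integral_complex_ofReal]
    refine integral_congr_ae (.of_forall fun u => ?_)
    simp only [hφ, add_comm (u : ℂ)]
    by_cases h : g (y * I + u) = 0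
    · simp [h]
    · exact div_mul_cancel₀ _ h
  rw [hFy, norm_real] at key
  exact (le_abs_self _).trans key

/-- Phragmén–Lindelöf principle in a horizontal strip, with `L¹` norms in place of sup norms. -/
theorem integrable_and_integral_norm_le_of_horizontal_strip {g : ℂ → ℂ} {U : Set ℂ}
    {y₁ y₂ s M K : ℝ} (hy : y₁ < y₂) (hU : IsOpen U) (hsub : im ⁻¹' Icc y₁ y₂ ⊆ U)
    (hg : DifferentiableOn ℂ g U) (hs : 0 ≤ s)
    (hM : ∀ z : ℂ, z.im ∈ Icc y₁ y₂ → ‖g z‖ ≤ M * Real.exp (s * |z.re|))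
    (hi₁ : Integrable (fun x : ℝ => g (x + y₁ * I)))
    (hi₂ : Integrable (fun x : ℝ => g (x + y₂ * I)))
    (h₁ : ∫ x : ℝ, ‖g (x + y₁ * I)‖ ≤ K) (h₂ : ∫ x : ℝ, ‖g (x + y₂ * I)‖ ≤ K)
    {y : ℝ} (hyy : y ∈ Icc y₁ y₂) :
    Integrable (fun x : ℝ => g (x + y * I)) ∧ ∫ x : ℝ, ‖g (x + y * I)‖ ≤ K := by
  have hcov : AECover (volume : Measure ℝ) Filter.atTop fun n : ℕ => Icc (-(n : ℝ)) n :=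
    aecover_Icc (Filter.tendsto_neg_atTop_atBot.comp tendsto_natCast_atTop_atTop)
      tendsto_natCast_atTop_atTop
  have hcont : Continuous (fun x : ℝ => g (x + y * I)) :=
    hg.continuousOn.comp_continuous (by fun_prop) fun u => hsub (by simpa using hyy)
  have hle : ∀ n : ℕ, ∫ x in Icc (-(n : ℝ)) n, ‖g (x + y * I)‖ ≤ K := fun n =>
    setIntegral_norm_le_of_horizontal_strip hy hU hsub hg hs hM hi₁ hi₂ h₁ h₂ hyy
  have hint := hcov.integrable_of_integral_norm_bounded K
    (fun n => hcont.integrableOn_Icc) (.of_forall hle)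
  exact ⟨hint, le_of_tendsto (hcov.integral_tendsto_of_countably_generated hint.norm)
    (.of_forall hle)⟩

/-- A holomorphic function vanishing on a horizontal line vanishes on any connected domain
containing a point of that line. -/
theorem eq_zero_of_horizontal_line {f : ℂ → ℂ} {U : Set ℂ} (hU : IsOpen U)
    (hUc : IsPreconnected U) (hf : DifferentiableOn ℂ f U) {c : ℂ} (hc : c ∈ U)
    (h0 : ∀ x : ℝ, f (x + c) = 0) : EqOn f 0 U := by
  refine (hf.analyticOnNhd hU).eqOn_zero_of_preconnected_of_frequently_eq_zero hUc hc ?_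
  have ht : Filter.Tendsto (fun x : ℝ => (x : ℂ) + c) (nhdsWithin 0 {0}ᶜ) (nhdsWithin c {c}ᶜ) := by
    refine tendsto_nhdsWithin_iff.2 ⟨?_, ?_⟩
    · have : Continuous (fun x : ℝ => (x : ℂ) + c) := by fun_prop
      simpa using (this.tendsto 0).mono_left nhdsWithin_le_nhds
    · filter_upwards [self_mem_nhdsWithin] with x hx
      simpa using hx
  exact ht.frequently (Filter.Eventually.of_forall h0).frequently

/-- A real function locally bounded above on a compact set is bounded above on it. -/
theorem IsCompact.exists_upper_bound_of_locally {X : Type*} [TopologicalSpace X] {S : Set X}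
    (hS : IsCompact S) {C : X → ℝ}
    (h : ∀ x ∈ S, ∃ M : ℝ, ∀ᶠ x' in nhdsWithin x S, C x' ≤ M) : ∃ M : ℝ, ∀ x ∈ S, C x ≤ M := by
  refine hS.induction_on (p := fun T => ∃ M : ℝ, ∀ x ∈ T, C x ≤ M) ⟨0, by simp⟩
    (fun T T' hT ⟨M, hM⟩ => ⟨M, fun x hx => hM x (hT hx)⟩) ?_ ?_
  · rintro T T' ⟨M, hM⟩ ⟨M', hM'⟩
    refine ⟨max M M', ?_⟩
    rintro x (hx | hx)
    · exact (hM x hx).trans (le_max_left _ _)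
    · exact (hM' x hx).trans (le_max_right _ _)
  · intro x hx
    obtain ⟨M, hM⟩ := h x hx
    exact ⟨_, hM, M, fun _ h => h⟩

/-- `L¹` Phragmén–Lindelöf principle: if `f` is holomorphic of exponential type on
the strip `Ω_{a,b}` and integrable on the lines `ℝ - i t₁` and `ℝ - i t₂`
(`a < t₁ < t₂ < b`), then `f` is integrable on every intermediate line `ℝ - i t`,
and `t ↦ log ‖f(· - i t)‖_{L¹}` is convex on `[t₁, t₂]`. -/
theorem L1_phragmen_lindelof (a b s t₁ t₂ : ℝ) (C : ℝ → ℝ) (f : ℂ → ℂ)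
    (hab : a < b) (ht₁ : a < t₁) (h₁₂ : t₁ < t₂) (ht₂ : t₂ < b)
    (hf : DifferentiableOn ℂ f {z : ℂ | z.im ∈ Set.Ioo (-b) (-a)})
    (hC : ∀ t ∈ Set.Ioo a b, ∃ ε > 0, ∃ M : ℝ, ∀ t' ∈ Set.Ioo a b,
      |t' - t| < ε → C t' ≤ M)
    (hgrowth : ∀ (x : ℝ), ∀ t ∈ Set.Ioo a b,
      ‖f (x - t * Complex.I)‖ ≤ C t * Real.exp (s * |x|))
    (hint₁ : Integrable (fun x : ℝ => f (x - t₁ * Complex.I)))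
    (hint₂ : Integrable (fun x : ℝ => f (x - t₂ * Complex.I))) :
    (∀ t ∈ Set.Icc t₁ t₂, Integrable (fun x : ℝ => f (x - t * Complex.I))) ∧
      ConvexOn ℝ (Set.Icc t₁ t₂)
        (fun t : ℝ => Real.log (∫ x : ℝ, ‖f (x - t * Complex.I)‖)) := by
  set U : Set ℂ := {z : ℂ | z.im ∈ Set.Ioo (-b) (-a)} with hUdef
  have hU : IsOpen U := isOpen_Ioo.preimage continuous_im
  have hUc : IsPreconnected U :=
    ((convex_Ioo (-b) (-a)).linear_preimage Complex.imLm).isPreconnected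
  have hline : ∀ (x t : ℝ), (x : ℂ) - t * I = x + ((-t : ℝ) : ℂ) * I := by
    intro x t
    push_cast
    ring
  have hIoo : ∀ t ∈ Icc t₁ t₂, t ∈ Ioo a b := fun t ht =>
    ⟨ht₁.trans_le ht.1, ht.2.trans_lt ht₂⟩
  obtain ⟨M, hM⟩ : ∃ M : ℝ, ∀ t ∈ Icc t₁ t₂, C t ≤ M := by
    refine isCompact_Icc.exists_upper_bound_of_locally fun t ht => ?_
    obtain ⟨ε, hε, M, hM⟩ := hC t (hIoo t ht)
    refine ⟨M, ?_⟩
    filter_upwards [self_mem_nhdsWithin, mem_nhdsWithin_of_mem_nhds (Metric.ball_mem_nhds t hε)]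
      with t' h h' using hM t' (hIoo t' h) h'
  have hbound : ∀ z : ℂ, -z.im ∈ Icc t₁ t₂ → ‖f z‖ ≤ |M| * Real.exp (|s| * |z.re|) := by
    intro z hz
    have h := hgrowth z.re (-z.im) (hIoo _ hz)
    rw [hline, neg_neg, re_add_im] at h
    refine h.trans (mul_le_mul ((hM _ hz).trans (le_abs_self M)) ?_ (Real.exp_pos _).le
      (abs_nonneg M))
    gcongr
    exact le_abs_self s
  have hmem : ∀ t ∈ Icc t₁ t₂, ∀ x : ℝ, (x : ℂ) - t * I ∈ U := by
    intro t ht x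
    have := hIoo t ht
    simpa [hUdef] using this.symm
  have hcont : ∀ t ∈ Icc t₁ t₂, Continuous (fun x : ℝ => f (x - t * I)) := fun t ht =>
    hf.continuousOn.comp_continuous (by fun_prop) (hmem t ht)
  have key : ∀ (p q l K : ℝ), p ∈ Icc t₁ t₂ → q ∈ Icc t₁ t₂ → p < q →
      Integrable (fun x : ℝ => f (x - p * I)) → Integrable (fun x : ℝ => f (x - q * I)) →
      Real.exp (l * p) * ∫ x : ℝ, ‖f (x - p * I)‖ ≤ K →
      Real.exp (l * q) * ∫ x : ℝ, ‖f (x - q * I)‖ ≤ K → ∀ t ∈ Icc p q,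
      Integrable (fun x : ℝ => f (x - t * I)) ∧
        Real.exp (l * t) * ∫ x : ℝ, ‖f (x - t * I)‖ ≤ K := by
    intro p q l K hp hq hpq hip hiq hKp hKq t ht
    set g : ℂ → ℂ := fun z => exp (l * I * z) * f z with hg
    have hexp : ∀ z : ℂ, ‖exp (l * I * z)‖ = Real.exp (l * -z.im) := by
      intro z
      simp [Complex.norm_exp]
    have hnorm' : ∀ t' x : ℝ, ‖g (x + ((-t' : ℝ) : ℂ) * I)‖ =
        Real.exp (l * t') * ‖f (x - t' * I)‖ := by
      intro t' x
      simp only [hg, norm_mul, hexp, ← hline]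
      simp
    have hnorm : ∀ t' : ℝ, ∫ x : ℝ, ‖g (x + ((-t' : ℝ) : ℂ) * I)‖ =
        Real.exp (l * t') * ∫ x : ℝ, ‖f (x - t' * I)‖ := by
      intro t'
      simp only [hnorm', integral_const_mul]
    have hint : ∀ t' ∈ Icc t₁ t₂, (Integrable (fun x : ℝ => f (x - t' * I)) ↔
        Integrable (fun x : ℝ => g (x + ((-t' : ℝ) : ℂ) * I))) := by
      intro t' ht'
      have hgc : Continuous (fun x : ℝ => g (x + ((-t' : ℝ) : ℂ) * I)) := by
        simp only [hg, ← hline]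
        exact Continuous.mul (by fun_prop) (hcont t' ht')
      rw [← integrable_norm_iff (hcont t' ht').aestronglyMeasurable,
        ← integrable_norm_iff hgc.aestronglyMeasurable]
      simp only [hnorm']
      exact (integrable_const_mul_iff (Real.exp_pos _).ne'.isUnit _).symm
    have hgd : DifferentiableOn ℂ g U := by
      refine DifferentiableOn.mul ?_ hf
      fun_prop
    have := integrable_and_integral_norm_le_of_horizontal_strip (g := g) (U := U)
      (y₁ := -q) (y₂ := -p) (s := |s|) (M := Real.exp (|l| * (|t₁| + |t₂|)) * |M|) (K := K)
      (neg_lt_neg hpq) hU ?_ hgd (abs_nonneg s) ?_ ((hint q hq).1 hiq) ((hint p hp).1 hip)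
      ((hnorm q).trans_le hKq) ((hnorm p).trans_le hKp) (y := -t)
      ⟨neg_le_neg ht.2, neg_le_neg ht.1⟩
    · rwa [hnorm, ← hint t ⟨hp.1.trans ht.1, ht.2.trans hq.2⟩] at this
    · intro z hz
      exact ⟨by linarith [hz.1, hq.2], by linarith [hz.2, hp.1]⟩
    · intro z hz
      have hz' : -z.im ∈ Icc t₁ t₂ :=
        ⟨by linarith [hz.2, hp.1], by linarith [hz.1, hq.2]⟩
      rw [hg, norm_mul, hexp, mul_assoc]
      refine mul_le_mul (Real.exp_le_exp.2 ?_) (hbound z hz') (norm_nonneg _) (Real.exp_pos _).le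
      refine (le_abs_self _).trans ?_
      rw [abs_mul]
      refine mul_le_mul_of_nonneg_left (abs_le.2 ⟨?_, ?_⟩) (abs_nonneg l)
      · linarith [hz'.1, neg_abs_le t₁, abs_nonneg t₂]
      · linarith [hz'.2, le_abs_self t₂, abs_nonneg t₁]
  have hint : ∀ t ∈ Icc t₁ t₂, Integrable (fun x : ℝ => f (x - t * I)) := fun t ht =>
    (key t₁ t₂ 0 _ (left_mem_Icc.2 h₁₂.le) (right_mem_Icc.2 h₁₂.le) h₁₂ hint₁ hint₂
      (le_max_left _ _) (le_max_right _ _) t ht).1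
  refine ⟨hint, ?_⟩
  by_cases hpos : ∀ t ∈ Icc t₁ t₂, 0 < ∫ x : ℝ, ‖f (x - t * I)‖
  · refine LinearOrder.convexOn_of_lt (convex_Icc t₁ t₂) ?_
    intro p hp q hq hpq α β hα hβ hαβ
    set A := ∫ x : ℝ, ‖f (x - p * I)‖ with hA
    set B := ∫ x : ℝ, ‖f (x - q * I)‖ with hB
    have hA0 : 0 < A := hpos p hp
    have hB0 : 0 < B := hpos q hq
    set l := (Real.log A - Real.log B) / (q - p) with hl
    have hlpq : Real.log A + l * p = Real.log B + l * q := by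
      have : l * (q - p) = Real.log A - Real.log B := div_mul_cancel₀ _ (sub_pos.2 hpq).ne'
      linarith
    have ht : α * p + β * q ∈ Icc p q := convex_Icc p q (left_mem_Icc.2 hpq.le)
      (right_mem_Icc.2 hpq.le) hα.le hβ.le hαβ
    have htI : α * p + β * q ∈ Icc t₁ t₂ := ⟨hp.1.trans ht.1, ht.2.trans hq.2⟩
    have h := (key p q l (Real.exp (Real.log A + l * p)) hp hq hpq (hint p hp) (hint q hq)
      (by rw [Real.exp_add, Real.exp_log hA0, mul_comm])
      (by rw [hlpq, Real.exp_add, Real.exp_log hB0, mul_comm]) _ ht).2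
    have hT0 := hpos _ htI
    simp only [smul_eq_mul]
    set T := ∫ x : ℝ, ‖f (x - ((α * p + β * q : ℝ) : ℂ) * I)‖
    rw [← Real.exp_log hT0, ← Real.exp_add, Real.exp_le_exp] at h
    have h1 : α * (Real.log A + l * p) + β * (Real.log B + l * q) = Real.log A + l * p := by
      rw [← hlpq, ← add_mul, hαβ, one_mul]
    nlinarith
  · push Not at hpos
    obtain ⟨t, ht, h0⟩ := hpos
    have hz : EqOn f 0 U := by
      refine eq_zero_of_horizontal_line hU hUc hf (c := -(t * I)) ?_ fun x => ?_
      · simpa using hmem t ht 0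
      have h0' := le_antisymm h0 (integral_nonneg fun x => norm_nonneg _)
      rw [integral_eq_zero_iff_of_nonneg (fun x => norm_nonneg _) (hint t ht).norm,
        (hcont t ht).norm.ae_eq_iff_eq volume continuous_zero] at h0'
      simpa [sub_eq_add_neg] using congrFun h0' x
    refine (convexOn_const (0 : ℝ) (convex_Icc t₁ t₂)).congr fun t ht => ?_
    simp [hz (hmem t ht _)]
end

section
/- For every b ∈ ℂ, ∑_{n=0}^{∞} ((-1)^n / (n + 1/2)) · sin(√(b² + π²(n+1/2)²)) / √(b² + π²(n+1/2)²) = (π/2) · sin(b)/b, where the function sin(w)/w is extended by its value 1 at w = 0 and the square roots cancel since sin(w)/w is an even entire function of w. -/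
open Real

/-- The entire function `ζ ↦ sin(√ζ)/√ζ`. -/
noncomputable def sincSqrt (ζ : ℂ) : ℂ :=
  ∑' k : ℕ, ((-1 : ℂ) ^ k * ζ ^ k) / ((2 * k + 1).factorial : ℂ)

lemma hasSum_cos_div_sq {y : ℝ} (hy : y ∈ Set.Icc (0 : ℝ) 1) :
    HasSum (fun n : ℕ => 1 / (n : ℝ) ^ 2 * cos (2 * π * n * y)) (π ^ 2 * (y ^ 2 - y + 1 / 6)) := by
  have h := hasSum_one_div_nat_pow_mul_cos (k := 1) one_ne_zero hy
  convert h using 1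
  have hB : (Polynomial.bernoulli 2) = Polynomial.X ^ 2 - Polynomial.X + Polynomial.C (1 / 6) := by
    refine Polynomial.funext fun r => ?_
    simp [Polynomial.bernoulli_def, Finset.sum_range_succ, bernoulli_two]
    ring
  simp only [mul_one, hB, Polynomial.map_add, Polynomial.map_sub, Polynomial.map_pow, Polynomial.map_X,
    Polynomial.map_C, Polynomial.eval_add, Polynomial.eval_sub, Polynomial.eval_pow,
    Polynomial.eval_X, Polynomial.eval_C]
  rw [show algebraMap ℚ ℝ (1 / 6) = 1 / 6 by norm_num,
    show (Nat.factorial 2 : ℝ) = 2 by norm_num]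
  ring

/-- Fourier series of the triangle wave. -/
lemma hasSum_triangle_wave {t : ℝ} (ht : t ∈ Set.Icc (0 : ℝ) 1) :
    HasSum (fun n : ℕ => (-1 : ℝ) ^ n / ((n : ℝ) + 1 / 2) ^ 2 * sin (π * ((n : ℝ) + 1 / 2) * t))
      (π ^ 2 / 2 * t) := by
  obtain ⟨h0, h1⟩ := ht
  have hall := hasSum_cos_div_sq (y := (1 - t) / 4) ⟨by linarith, by linarith⟩
  have heven : HasSum (fun n : ℕ => 1 / ((2 * n : ℕ) : ℝ) ^ 2 *
      cos (2 * π * ((2 * n : ℕ) : ℝ) * ((1 - t) / 4)))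
      (π ^ 2 * (((1 - t) / 2) ^ 2 - (1 - t) / 2 + 1 / 6) / 4) := by
    refine ((hasSum_cos_div_sq (y := (1 - t) / 2) ⟨by linarith, by linarith⟩).div_const
      4).congr_fun fun n => ?_
    push_cast
    rw [show 2 * π * (2 * (n : ℝ)) * ((1 - t) / 4) = 2 * π * n * ((1 - t) / 2) by ring]
    ring
  have hodd : Summable (fun n : ℕ => 1 / ((2 * n + 1 : ℕ) : ℝ) ^ 2 *
      cos (2 * π * ((2 * n + 1 : ℕ) : ℝ) * ((1 - t) / 4))) :=
    hall.summable.comp_injective (i := fun n : ℕ => 2 * n + 1) fun a b h => by simpa using h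
  have heq := (heven.even_add_odd (f := fun n : ℕ => 1 / (n : ℝ) ^ 2 *
      cos (2 * π * n * ((1 - t) / 4))) hodd.hasSum).unique hall
  have key := hodd.hasSum.mul_left 4
  have hval : π ^ 2 / 2 * t = 4 * ∑' n : ℕ, 1 / ((2 * n + 1 : ℕ) : ℝ) ^ 2 *
      cos (2 * π * ((2 * n + 1 : ℕ) : ℝ) * ((1 - t) / 4)) := by
    linear_combination (-4 : ℝ) * heq
  rw [hval]
  refine key.congr_fun fun n => ?_
  have : 2 * π * ((2 * n + 1 : ℕ) : ℝ) * ((1 - t) / 4)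
      = π / 2 - π * ((n : ℝ) + 1 / 2) * t + n * π := by
    push_cast; ring
  rw [this, cos_add_nat_mul_pi, cos_pi_div_two_sub]
  push_cast
  have : (n : ℝ) + 1 / 2 ≠ 0 := by positivity
  have : (2 * n : ℝ) + 1 ≠ 0 := by positivity
  field_simp
  ring

lemma summable_one_div_add_half_sq : Summable fun n : ℕ => 1 / ((n : ℝ) + 1 / 2) ^ 2 := by
  have := (summable_one_div_nat_add_rpow (1 / 2) 2).2 one_lt_two
  simpa using this

lemma integral_mul_cos_eq {p p' : ℝ → ℝ} (hp : ∀ t, HasDerivAt p (p' t) t)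
    (hc : Continuous p') {x : ℝ} (hx : x ≠ 0) :
    ∫ t in (0 : ℝ)..1, p t * cos (x * t) =
      p 1 * (sin x / x) - ∫ t in (0 : ℝ)..1, p' t * (sin (x * t) / x) := by
  have hs : ∀ t, HasDerivAt (fun t => sin (x * t) / x) (cos (x * t)) t := fun t => by
    have := (((hasDerivAt_id t).const_mul x).sin).div_const x
    simpa [hx] using this
  rw [intervalIntegral.integral_mul_deriv_eq_deriv_mul (fun t _ => hp t) (fun t _ => hs t)
    (hc.intervalIntegrable _ _) ((by fun_prop : Continuous _).intervalIntegrable _ _)]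
  simp

/-- Termwise integration of the Fourier series of the constant function `π / 2` on `[0, 1)`
against a continuously differentiable function. -/
lemma hasSum_integral_mul_cos {p p' : ℝ → ℝ} (hp : ∀ t, HasDerivAt p (p' t) t)
    (hc : Continuous p') :
    HasSum (fun n : ℕ => (-1 : ℝ) ^ n / ((n : ℝ) + 1 / 2) *
        ∫ t in (0 : ℝ)..1, p t * cos (π * ((n : ℝ) + 1 / 2) * t))
      (π / 2 * ∫ t in (0 : ℝ)..1, p t) := by
  set T : ℕ → ℝ → ℝ := fun n t =>
    (-1 : ℝ) ^ n / ((n : ℝ) + 1 / 2) ^ 2 * sin (π * ((n : ℝ) + 1 / 2) * t) with hT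
  have hI : HasSum (fun n => ∫ t in (0 : ℝ)..1, p' t * T n t)
      (∫ t in (0 : ℝ)..1, p' t * (π ^ 2 / 2 * t)) := by
    refine intervalIntegral.hasSum_integral_of_dominated_convergence
      (fun n t => |p' t| * (1 / ((n : ℝ) + 1 / 2) ^ 2)) (fun n => ?_) (fun n => ?_) ?_ ?_ ?_
    · exact (by fun_prop : Continuous fun t => p' t * T n t).aestronglyMeasurable
    · refine .of_forall fun t _ => ?_
      rw [norm_mul, Real.norm_eq_abs, Real.norm_eq_abs, hT]
      simp only [abs_mul, abs_div, abs_pow, abs_neg, abs_one, one_pow, sq_abs]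
      gcongr
      exact mul_le_of_le_one_right (by positivity) (abs_sin_le_one _)
    · exact .of_forall fun t _ => summable_one_div_add_half_sq.mul_left _
    · simp_rw [tsum_mul_left]
      exact (by fun_prop : Continuous _).intervalIntegrable _ _
    · refine .of_forall fun t ht => ?_
      rw [Set.uIoc_of_le zero_le_one] at ht
      exact (hasSum_triangle_wave (Set.Ioc_subset_Icc_self ht)).mul_left _
  have h1 := (((hasSum_triangle_wave (t := 1) (by simp)).mul_left (p 1)).sub hI).mul_left (1 / π)
  have hibp : ∫ t in (0 : ℝ)..1, p t = p 1 - ∫ t in (0 : ℝ)..1, p' t * t := by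
    have := intervalIntegral.integral_mul_deriv_eq_deriv_mul (a := 0) (b := 1) (v := id)
      (v' := fun _ => 1) (fun t _ => hp t) (fun t _ => hasDerivAt_id t)
      (hc.intervalIntegrable _ _) ((by fun_prop : Continuous _).intervalIntegrable _ _)
    simpa using this
  have hval : π / 2 * ∫ t in (0 : ℝ)..1, p t =
      1 / π * (p 1 * (π ^ 2 / 2 * 1) - ∫ t in (0 : ℝ)..1, p' t * (π ^ 2 / 2 * t)) := by
    simp_rw [hibp, mul_left_comm _ (π ^ 2 / 2) _, intervalIntegral.integral_const_mul]
    field_simp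
  rw [hval]
  refine h1.congr_fun fun n => ?_
  have hn : (n : ℝ) + 1 / 2 ≠ 0 := by positivity
  have hint : ∫ t in (0 : ℝ)..1, p' t * T n t = (-1 : ℝ) ^ n * π / ((n : ℝ) + 1 / 2) *
      ∫ t in (0 : ℝ)..1, p' t * (sin (π * ((n : ℝ) + 1 / 2) * t) / (π * ((n : ℝ) + 1 / 2))) := by
    rw [← intervalIntegral.integral_const_mul]
    congr 1 with t
    simp only [hT]
    field_simp
  rw [integral_mul_cos_eq hp hc (by positivity), hint]
  simp only [mul_one]
  field_simp

lemma abs_integral_mul_cos_le {p p' : ℝ → ℝ} (hp : ∀ t, HasDerivAt p (p' t) t)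
    (hc : Continuous p') (hneg : ∀ t ∈ Set.Icc (0 : ℝ) 1, p' t ≤ 0) (h1 : 0 ≤ p 1)
    {x : ℝ} (hx : 0 < x) :
    |∫ t in (0 : ℝ)..1, p t * cos (x * t)| ≤ p 0 / x := by
  have hint : |∫ t in (0 : ℝ)..1, p' t * (sin (x * t) / x)| ≤ (p 0 - p 1) / x := by
    have hval : ∫ t in (0 : ℝ)..1, -p' t / x = (p 0 - p 1) / x := by
      rw [intervalIntegral.integral_div, intervalIntegral.integral_neg,
        intervalIntegral.integral_eq_sub_of_hasDerivAt (fun t _ => hp t)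
          (hc.intervalIntegrable _ _), neg_sub]
    rw [← hval, ← Real.norm_eq_abs]
    refine intervalIntegral.norm_integral_le_of_norm_le zero_le_one (.of_forall fun t ht => ?_)
      ((by fun_prop : Continuous _).intervalIntegrable _ _)
    rw [Real.norm_eq_abs, abs_mul, abs_div, abs_of_pos hx,
      abs_of_nonpos (hneg t (Set.Ioc_subset_Icc_self ht)), ← mul_div_assoc]
    gcongr
    exact mul_le_of_le_one_right
      (neg_nonneg.2 (hneg t (Set.Ioc_subset_Icc_self ht))) (abs_sin_le_one _)
  rw [integral_mul_cos_eq hp hc hx.ne']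
  calc _ ≤ |p 1 * (sin x / x)| + |∫ t in (0 : ℝ)..1, p' t * (sin (x * t) / x)| := abs_sub _ _
    _ ≤ p 1 / x + (p 0 - p 1) / x := by
        gcongr
        rw [abs_mul, abs_div, abs_of_pos hx, abs_of_nonneg h1, ← mul_div_assoc]
        gcongr
        exact mul_le_of_le_one_right h1 (abs_sin_le_one _)
    _ = p 0 / x := by ring

lemma hasDerivAt_one_sub_sq_pow (k : ℕ) (t : ℝ) :
    HasDerivAt (fun t : ℝ => (1 - t ^ 2) ^ k) (k * (1 - t ^ 2) ^ (k - 1) * (-(2 * t))) t := by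
  simpa using ((hasDerivAt_pow 2 t).const_sub 1).fun_pow k

/-- The cosine transform on `[0, 1]` of `(1 - t²)ᵏ`. -/
noncomputable def cosTransform (k : ℕ) (x : ℝ) : ℝ :=
  ∫ t in (0 : ℝ)..1, (1 - t ^ 2) ^ k * cos (x * t)

lemma hasSum_cosTransform (k : ℕ) :
    HasSum (fun n : ℕ => (-1 : ℝ) ^ n / ((n : ℝ) + 1 / 2) *
      cosTransform k (π * ((n : ℝ) + 1 / 2))) (π / 2 * cosTransform k 0) := by
  simpa [cosTransform] using
    hasSum_integral_mul_cos (hasDerivAt_one_sub_sq_pow k) (by fun_prop)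

lemma abs_cosTransform_le (k : ℕ) {x : ℝ} (hx : 0 < x) : |cosTransform k x| ≤ 1 / x := by
  have := abs_integral_mul_cos_le (hasDerivAt_one_sub_sq_pow k) (by fun_prop)
    (fun t ht => mul_nonpos_of_nonneg_of_nonpos
      (mul_nonneg (by positivity) (pow_nonneg (by nlinarith [ht.1, ht.2]) _)) (by linarith [ht.1]))
    (by positivity) hx
  simpa [cosTransform] using this

/-- The even moments of `(1 - t²)ᵏ` on `[0, 1]`. -/
lemma integral_one_sub_sq_pow_mul_pow (k j : ℕ) :
    ∫ t in (0 : ℝ)..1, (1 - t ^ 2) ^ k * t ^ (2 * j) =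
      ((k + j).factorial * 4 ^ k * k.factorial * (2 * j).factorial : ℝ) /
        (j.factorial * (2 * (k + j) + 1).factorial) := by
  induction k generalizing j with
  | zero =>
    simp [Nat.factorial_succ]
    field_simp
  | succ k ih =>
    have hsub : ∀ t : ℝ, (1 - t ^ 2) ^ (k + 1) * t ^ (2 * j) =
        (1 - t ^ 2) ^ k * t ^ (2 * j) - (1 - t ^ 2) ^ k * t ^ (2 * (j + 1)) := fun t => by ring
    simp_rw [hsub]
    rw [intervalIntegral.integral_sub
      ((by fun_prop : Continuous _).intervalIntegrable _ _)
      ((by fun_prop : Continuous _).intervalIntegrable _ _), ih, ih]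
    rw [show k + 1 + j = k + j + 1 by ring, show k + (j + 1) = k + j + 1 by ring,
      show 2 * (k + j + 1) + 1 = 2 * (k + j) + 1 + 1 + 1 by ring,
      show 2 * (j + 1) = 2 * j + 1 + 1 by ring]
    simp only [Nat.factorial_succ]
    push_cast
    field_simp
    ring

lemma summable_abs_pow_div_factorial (x : ℝ) :
    Summable fun j : ℕ => |x| ^ (2 * j) / ((2 * j).factorial : ℝ) :=
  (Real.summable_pow_div_factorial |x|).comp_injective (i := fun j : ℕ => 2 * j)
    fun a b h => by simpa using h

lemma hasSum_cosTransform_taylor (k : ℕ) (x : ℝ) :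
    HasSum (fun j : ℕ => (-1) ^ j * x ^ (2 * j) / (2 * j).factorial *
      ∫ t in (0 : ℝ)..1, (1 - t ^ 2) ^ k * t ^ (2 * j)) (cosTransform k x) := by
  simp_rw [← intervalIntegral.integral_const_mul]
  refine intervalIntegral.hasSum_integral_of_dominated_convergence
    (fun j _ => |x| ^ (2 * j) / (2 * j).factorial) (fun j => ?_) (fun j => ?_) ?_ ?_ ?_
  · exact (by fun_prop : Continuous _).aestronglyMeasurable
  · refine .of_forall fun t ht => ?_
    rw [Set.uIoc_of_le zero_le_one] at ht
    have h2 : t ^ 2 ≤ 1 := pow_le_one₀ ht.1.le ht.2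
    have h3 : 0 ≤ 1 - t ^ 2 := by linarith
    have h4 : 0 ≤ t := ht.1.le
    simp only [norm_mul, norm_div, norm_pow, norm_neg, norm_one, one_pow, one_mul,
      Real.norm_eq_abs, Nat.abs_cast, abs_of_nonneg h3, abs_of_nonneg h4]
    refine mul_le_of_le_one_right (by positivity) (mul_le_one₀ ?_ (by positivity) ?_)
    · exact pow_le_one₀ h3 (by nlinarith)
    · exact pow_le_one₀ h4 ht.2
  · exact .of_forall fun t _ => summable_abs_pow_div_factorial x
  · exact intervalIntegrable_const
  · refine .of_forall fun t _ => ?_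
    refine ((Real.hasSum_cos (x * t)).mul_left ((1 - t ^ 2) ^ k)).congr_fun fun j => ?_
    rw [mul_pow]
    ring

lemma summable_pow_div_factorial_sq (z : ℂ) :
    Summable fun k : ℕ => ‖(-z / 4) ^ k / ((k.factorial : ℂ) ^ 2)‖ := by
  refine (Real.summable_pow_div_factorial ‖-z / 4‖).of_nonneg_of_le (fun _ => norm_nonneg _)
    fun k => ?_
  rw [norm_div, norm_pow, norm_pow, Complex.norm_natCast]
  have : (1 : ℝ) ≤ k.factorial := by exact_mod_cast k.factorial_pos
  gcongr
  exact le_self_pow₀ this two_ne_zero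

lemma taylor_coeff_eq (z : ℂ) (x : ℝ) (k j : ℕ) :
    (-z / 4) ^ k / ((k.factorial : ℂ) ^ 2) *
      (((-1) ^ j * x ^ (2 * j) / (2 * j).factorial *
        ∫ t in (0 : ℝ)..1, (1 - t ^ 2) ^ k * t ^ (2 * j) : ℝ) : ℂ) =
      (-1) ^ (k + j) * ((k + j).choose k • (z ^ k * ((x : ℂ) ^ 2) ^ j)) /
        ((2 * (k + j) + 1).factorial : ℂ) := by
  have hf : ∀ n : ℕ, (n.factorial : ℂ) ≠ 0 := fun n => by exact_mod_cast n.factorial_ne_zero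
  have hk := hf k
  have hj := hf j
  have h2j := hf (2 * j)
  have hs := hf (2 * (k + j) + 1)
  rw [integral_one_sub_sq_pow_mul_pow, nsmul_eq_mul, Nat.cast_add_choose, div_pow, neg_pow]
  push_cast
  field_simp
  ring

/-- The double power series of `sincSqrt (z + x²)` in `z` and `x²`. -/
noncomputable def taylorTerm (z : ℂ) (x : ℝ) (q : ℕ × ℕ) : ℂ :=
  (-z / 4) ^ q.1 / ((q.1.factorial : ℂ) ^ 2) *
    (((-1) ^ q.2 * x ^ (2 * q.2) / (2 * q.2).factorial *
      ∫ t in (0 : ℝ)..1, (1 - t ^ 2) ^ q.1 * t ^ (2 * q.2) : ℝ) : ℂ)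

lemma abs_integral_one_sub_sq_pow_mul_pow_le (k j : ℕ) :
    |∫ t in (0 : ℝ)..1, (1 - t ^ 2) ^ k * t ^ (2 * j)| ≤ 1 := by
  have hle := intervalIntegral.norm_integral_le_of_norm_le_const (a := 0) (b := 1) (C := 1)
    (f := fun t : ℝ => (1 - t ^ 2) ^ k * t ^ (2 * j)) fun t ht => ?_
  · simpa using hle
  · rw [Set.uIoc_of_le zero_le_one] at ht
    have h2 : t ^ 2 ≤ 1 := pow_le_one₀ ht.1.le ht.2
    have h3 : 0 ≤ 1 - t ^ 2 := by linarith
    have h4 : 0 ≤ t := ht.1.le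
    rw [Real.norm_eq_abs, abs_of_nonneg (by positivity)]
    exact mul_le_one₀ (pow_le_one₀ h3 (by nlinarith)) (by positivity) (pow_le_one₀ h4 ht.2)

lemma summable_taylorTerm (z : ℂ) (x : ℝ) : Summable (taylorTerm z x) := by
  refine Summable.of_norm_bounded ((summable_pow_div_factorial_sq z).mul_of_nonneg
    (summable_abs_pow_div_factorial x) (fun _ => norm_nonneg _) (fun _ => by positivity))
    fun q => ?_
  rw [taylorTerm, norm_mul]
  refine mul_le_mul_of_nonneg_left ?_ (norm_nonneg _)
  rw [Complex.norm_real, Real.norm_eq_abs, abs_mul, abs_div, abs_mul, abs_pow, abs_neg, abs_one,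
    one_pow, one_mul, abs_pow, Nat.abs_cast]
  exact mul_le_of_le_one_right (by positivity) (abs_integral_one_sub_sq_pow_mul_pow_le _ _)

lemma tsum_taylorTerm (z : ℂ) (x : ℝ) :
    ∑' q, taylorTerm z x q = sincSqrt (z + (x : ℂ) ^ 2) := by
  have hsigma := Finset.HasAntidiagonal.sigmaAntidiagonalEquivProd.summable_iff.2
    (summable_taylorTerm z x)
  rw [← Finset.HasAntidiagonal.sigmaAntidiagonalEquivProd.tsum_eq (taylorTerm z x)]
  refine hsigma.tsum_sigma.trans (tsum_congr fun m => ?_)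
  refine (Finset.tsum_subtype (Finset.HasAntidiagonal.antidiagonal m) (taylorTerm z x)).trans ?_
  rw [(Commute.all z ((x : ℂ) ^ 2)).add_pow', Finset.mul_sum, Finset.sum_div]
  refine Finset.sum_congr rfl fun ⟨k, j⟩ hq => ?_
  obtain rfl : k + j = m := by simpa using hq
  exact taylor_coeff_eq z x k j

/-- The Taylor expansion of `sincSqrt` at `x²`, with the coefficients in integral form. -/
lemma hasSum_sincSqrt_add_sq (z : ℂ) (x : ℝ) :
    HasSum (fun k : ℕ => (-z / 4) ^ k / ((k.factorial : ℂ) ^ 2) * (cosTransform k x : ℂ))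
      (sincSqrt (z + (x : ℂ) ^ 2)) := by
  rw [← tsum_taylorTerm]
  refine (summable_taylorTerm z x).hasSum.prod_fiberwise fun k => ?_
  have h : HasSum _ (cosTransform k x : ℂ) :=
    Complex.hasSum_ofReal.2 (hasSum_cosTransform_taylor k x)
  simpa only [taylorTerm] using h.mul_left ((-z / 4) ^ k / ((k.factorial : ℂ) ^ 2))

/-- Gosper's sine series, for arbitrary complex `b`:
`∑ (-1)ⁿ/(n+1/2) · sin(√(b²+π²(n+1/2)²))/√(b²+π²(n+1/2)²) = (π/2) · sin(b)/b`. -/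
theorem gosper_sine_series (b : ℂ) :
    (∑' n : ℕ, ((-1 : ℂ) ^ n / ((n : ℂ) + 1/2)) *
        sincSqrt (b ^ 2 + (Real.pi : ℂ) ^ 2 * ((n : ℂ) + 1/2) ^ 2)) =
      ((Real.pi : ℂ) / 2) * sincSqrt (b ^ 2) := by
  set c : ℕ → ℂ := fun k => (-b ^ 2 / 4) ^ k / ((k.factorial : ℂ) ^ 2) with hc
  set g : ℕ → ℕ → ℂ := fun n k => c k * (((-1 : ℝ) ^ n / ((n : ℝ) + 1 / 2) *
    cosTransform k (π * ((n : ℝ) + 1 / 2)) : ℝ) : ℂ) with hg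
  have hrow : ∀ n : ℕ, ((-1 : ℂ) ^ n / ((n : ℂ) + 1 / 2)) *
      sincSqrt (b ^ 2 + (Real.pi : ℂ) ^ 2 * ((n : ℂ) + 1 / 2) ^ 2) = ∑' k, g n k := fun n => by
    have h := (hasSum_sincSqrt_add_sq (b ^ 2) (π * ((n : ℝ) + 1 / 2))).mul_left
      ((-1 : ℂ) ^ n / ((n : ℂ) + 1 / 2))
    push_cast at h
    rw [← mul_pow, ← h.tsum_eq]
    refine tsum_congr fun k => ?_
    simp only [hg, hc]
    push_cast
    ring
  have hsum : Summable (Function.uncurry g) := by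
    refine Summable.of_norm_bounded ((summable_one_div_add_half_sq.div_const π).mul_of_nonneg
      (summable_pow_div_factorial_sq (b ^ 2)) (fun _ => by positivity) (fun _ => norm_nonneg _))
      fun ⟨n, k⟩ => ?_
    have hn : (0 : ℝ) < (n : ℝ) + 1 / 2 := by positivity
    simp only [Function.uncurry_apply_pair, hg, hc]
    rw [norm_mul, mul_comm]
    gcongr
    rw [Complex.norm_real, Real.norm_eq_abs, abs_mul, abs_div, abs_pow, abs_neg, abs_one, one_pow,
      abs_of_pos hn]
    calc _ ≤ 1 / ((n : ℝ) + 1 / 2) * (1 / (π * ((n : ℝ) + 1 / 2))) := by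
          gcongr
          exact abs_cosTransform_le k (by positivity)
      _ = _ := by field_simp
  have hcol : ∀ k, ∑' n, g n k = (π / 2 : ℂ) * (c k * (cosTransform k 0 : ℂ)) := fun k => by
    have h := (Complex.hasSum_ofReal.2 (hasSum_cosTransform k)).mul_left (c k)
    rw [h.tsum_eq]
    push_cast
    ring
  have h0 := hasSum_sincSqrt_add_sq (b ^ 2) 0
  simp only [Complex.ofReal_zero, ne_eq, OfNat.ofNat_ne_zero, not_false_eq_true, zero_pow,
    add_zero] at h0
  rw [tsum_congr hrow, ← hsum.tsum_comm, tsum_congr hcol, tsum_mul_left, h0.tsum_eq]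
end

section
/- For every b ∈ ℂ, ∑_{n=1}^{∞} ((-1)^n / n²) · cos(√(b² + π² n²)) = (π²/4)(sin(b)/b − cos(b)/3), where cos(√ζ) denotes the entire function ∑_{k=0}^{∞} (-1)^k ζ^k/(2k)! evaluated at ζ = b² + π² n², and sin(b)/b is the entire function with value 1 at b = 0. -/
open Real

/-- The entire function `ζ ↦ cos(√ζ)`. -/
noncomputable def cosSqrt (ζ : ℂ) : ℂ :=
  ∑' k : ℕ, ((-1 : ℂ) ^ k * ζ ^ k) / ((2 * k).factorial : ℂ)

theorem differentiable_cosSqrt : Differentiable ℂ cosSqrt := by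
  intro z
  have h : DifferentiableOn ℂ cosSqrt (Metric.ball 0 (‖z‖ + 1)) := by
    refine Complex.differentiableOn_tsum_of_summable_norm
      (Real.summable_pow_div_factorial (‖z‖ + 1)) (fun k ↦ ?_) Metric.isOpen_ball
      fun k w hw ↦ ?_
    · fun_prop
    · have hw' : ‖w‖ ≤ ‖z‖ + 1 := (mem_ball_zero_iff.mp hw).le
      have hk : (k.factorial : ℝ) ≤ (2 * k).factorial := by
        exact_mod_cast Nat.factorial_le (by omega)
      simp only [norm_div, norm_mul, norm_pow, norm_neg, norm_one, one_pow, one_mul,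
        Complex.norm_natCast]
      gcongr
  exact h.differentiableAt (Metric.isOpen_ball.mem_nhds (by simp))

theorem cosSqrt_sq (z : ℂ) : cosSqrt (z ^ 2) = Complex.cos z := by
  rw [← (Complex.hasSum_cos z).tsum_eq]
  simp only [cosSqrt, pow_mul]

theorem sincSqrt_sq_mul (z : ℂ) : sincSqrt (z ^ 2) * z = Complex.sin z := by
  rw [← (Complex.hasSum_sin z).tsum_eq, sincSqrt, ← tsum_mul_right]
  exact tsum_congr fun k ↦ by ring

theorem hasDerivAt_iteratedDeriv_cosSqrt (k : ℕ) (z : ℂ) :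
    HasDerivAt (iteratedDeriv k cosSqrt) (iteratedDeriv (k + 1) cosSqrt z) z := by
  rw [iteratedDeriv_succ]
  exact ((differentiable_cosSqrt.contDiff (n := ⊤)).differentiable_iteratedDeriv k
    (by exact_mod_cast WithTop.coe_lt_top _) z).hasDerivAt

theorem two_mul_deriv_cosSqrt_sq (z : ℂ) :
    2 * z * iteratedDeriv 1 cosSqrt (z ^ 2) = -Complex.sin z := by
  have h := (hasDerivAt_iteratedDeriv_cosSqrt 0 (z ^ 2)).comp z (hasDerivAt_pow 2 z)
  have h' : iteratedDeriv 0 cosSqrt ∘ (fun w ↦ w ^ 2) = Complex.cos := by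
    ext w
    simp [cosSqrt_sq]
  rw [h'] at h
  rw [← h.unique (Complex.hasDerivAt_cos z)]
  push_cast
  ring

/-- The differential equation of `cosSqrt`, differentiated `k` times. -/
theorem iteratedDeriv_cosSqrt_recurrence (k : ℕ) (z : ℂ) :
    4 * z * iteratedDeriv (k + 2) cosSqrt z + (4 * k + 2) * iteratedDeriv (k + 1) cosSqrt z +
      iteratedDeriv k cosSqrt z = 0 := by
  induction k generalizing z with
  | zero =>
    obtain ⟨w, rfl⟩ : ∃ w, z = w ^ 2 := ⟨_, (Complex.cpow_nat_inv_pow z two_ne_zero).symm⟩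
    have h := ((hasDerivAt_id w).const_mul 2).mul
      ((hasDerivAt_iteratedDeriv_cosSqrt 1 (w ^ 2)).comp w (hasDerivAt_pow 2 w))
    have h' : HasDerivAt (fun w ↦ -Complex.sin w) (-Complex.cos w) w :=
      (Complex.hasDerivAt_sin w).neg
    rw [← funext two_mul_deriv_cosSqrt_sq] at h'
    have e := h.unique h'
    simp only [iteratedDeriv_zero, cosSqrt_sq, id, Function.comp] at e ⊢
    push_cast at e ⊢
    linear_combination e
  | succ k ih =>
    have h := ((((hasDerivAt_id z).const_mul 4).mul
      (hasDerivAt_iteratedDeriv_cosSqrt (k + 2) z)).add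
      ((hasDerivAt_iteratedDeriv_cosSqrt (k + 1) z).const_mul (4 * (k : ℂ) + 2))).add
      (hasDerivAt_iteratedDeriv_cosSqrt k z)
    have h' := (hasDerivAt_const z (0 : ℂ)).congr_of_eventuallyEq (.of_forall ih)
    have e := h.unique h'
    simp only [id] at e
    push_cast
    linear_combination e

theorem iteratedDeriv_one_cosSqrt_sq (z : ℂ) :
    iteratedDeriv 1 cosSqrt (z ^ 2) = -(1 / 2) * sincSqrt (z ^ 2) := by
  rcases eq_or_ne z 0 with rfl | hz
  · have h := iteratedDeriv_cosSqrt_recurrence 0 0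
    have h0 : cosSqrt 0 = 1 := by simpa using cosSqrt_sq 0
    have h1 : sincSqrt 0 = 1 := by
      rw [sincSqrt, tsum_eq_single 0 (by intro k hk; simp [hk])]
      simp
    simp only [iteratedDeriv_zero, h0] at h
    push_cast at h
    rw [zero_pow two_ne_zero, h1]
    linear_combination h / 2
  · apply mul_left_cancel₀ hz
    linear_combination two_mul_deriv_cosSqrt_sq z / 2 + sincSqrt_sq_mul z / 2

theorem hasDerivAt_pow_mul_iteratedDeriv_cosSqrt (k : ℕ) (c z : ℂ) :
    HasDerivAt (fun w ↦ w ^ (2 * k + 1) * iteratedDeriv (k + 1) cosSqrt (w ^ 2 * c))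
      (-(1 / 2) * z ^ (2 * k) * iteratedDeriv k cosSqrt (z ^ 2 * c)) z := by
  have h := (hasDerivAt_pow (2 * k + 1) z).mul
    ((hasDerivAt_iteratedDeriv_cosSqrt (k + 1) (z ^ 2 * c)).comp z
      ((hasDerivAt_pow 2 z).mul_const c))
  refine h.congr_deriv ?_
  push_cast [Function.comp_apply]
  linear_combination z ^ (2 * k) / 2 * iteratedDeriv_cosSqrt_recurrence k (z ^ 2 * c)

theorem norm_iteratedDeriv_cosSqrt_sq_le (k : ℕ) (s : ℝ) :
    ‖iteratedDeriv k cosSqrt ((s : ℂ) ^ 2)‖ ≤ (1 / 2) ^ k := by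
  induction k generalizing s with
  | zero =>
    simpa [cosSqrt_sq, ← Complex.ofReal_cos] using Real.abs_cos_le_one s
  | succ k ih =>
    rcases eq_or_ne s 0 with rfl | hs
    · have h := iteratedDeriv_cosSqrt_recurrence k 0
      have h0 : iteratedDeriv (k + 1) cosSqrt 0 =
          -(iteratedDeriv k cosSqrt 0) / ((4 * k + 2 : ℕ) : ℂ) := by
        rw [eq_div_iff (Nat.cast_ne_zero.mpr (by omega))]
        push_cast
        linear_combination h
      have ih0 := ih 0
      simp only [Complex.ofReal_zero, ne_eq, two_ne_zero, not_false_eq_true, zero_pow] at ih0 ⊢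
      rw [h0, norm_div, norm_neg, Complex.norm_natCast, pow_succ, div_eq_mul_inv]
      gcongr
      rw [← one_div]
      gcongr
      exact_mod_cast (by omega)
    · have h := Convex.norm_image_sub_le_of_norm_hasDerivWithin_le
        (s := Set.uIcc 0 s) (x := 0) (y := s) (C := 1 / 2 * |s| ^ (2 * k) * (1 / 2) ^ k)
        (fun x _ ↦ ((hasDerivAt_pow_mul_iteratedDeriv_cosSqrt k 1 x).comp_ofReal).hasDerivWithinAt)
        (fun x hx ↦ by
          have hx' : |x| ≤ |s| := by simpa using Set.abs_sub_left_of_mem_uIcc hx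
          simp only [norm_mul, norm_pow, mul_one, Complex.norm_real, Real.norm_eq_abs]
          have := ih x
          have e : ‖-(1 / 2 : ℂ)‖ = 1 / 2 := by simp
          rw [e]
          gcongr)
        (convex_uIcc _ _) Set.left_mem_uIcc Set.right_mem_uIcc
      have hs' : 0 < |s| ^ (2 * k + 1) := pow_pos (abs_pos.mpr hs) _
      simp only [Complex.ofReal_zero, ne_eq, Nat.add_eq_zero_iff, one_ne_zero, and_false,
        not_false_eq_true, zero_pow, zero_mul, sub_zero, mul_one, norm_mul, norm_pow,
        Complex.norm_real, Real.norm_eq_abs] at h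
      refine le_of_mul_le_mul_left (h.trans_eq ?_) hs'
      ring

theorem summable_norm_neg_one_pow_div_sq :
    Summable fun n : ℕ ↦ ‖(-1 : ℂ) ^ (n + 1) / ((n : ℂ) + 1) ^ 2‖ := by
  have h := (summable_nat_add_iff 1).mpr (Real.summable_one_div_nat_pow.mpr one_lt_two)
  refine h.congr fun n ↦ ?_
  have : ‖(n : ℂ) + 1‖ = n + 1 := by exact_mod_cast Complex.norm_natCast (n + 1)
  simp [this]

theorem norm_neg_one_pow_div_sq_mul_iteratedDeriv_cosSqrt_le (k n : ℕ) (s : ℝ) :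
    ‖(-1 : ℂ) ^ (n + 1) / ((n : ℂ) + 1) ^ 2 *
      iteratedDeriv k cosSqrt ((s : ℂ) ^ 2 * ((Real.pi : ℂ) ^ 2 * ((n : ℂ) + 1) ^ 2))‖ ≤
    ‖(-1 : ℂ) ^ (n + 1) / ((n : ℂ) + 1) ^ 2‖ * (1 / 2) ^ k := by
  rw [norm_mul]
  gcongr
  convert! norm_iteratedDeriv_cosSqrt_sq_le k (s * (Real.pi * (n + 1))) using 3
  push_cast
  ring

theorem tsum_neg_one_pow_div_sq_mul_cos {s : ℝ} (hs : s ∈ Set.Icc (0 : ℝ) 1) :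
    ∑' n : ℕ, (-1 : ℂ) ^ (n + 1) / ((n : ℂ) + 1) ^ 2 *
      cosSqrt ((s : ℂ) ^ 2 * ((Real.pi : ℂ) ^ 2 * ((n : ℂ) + 1) ^ 2)) =
    (Real.pi : ℂ) ^ 2 * ((s : ℂ) ^ 2 / 4 - 1 / 12) := by
  have h := hasSum_one_div_nat_pow_mul_cos one_ne_zero
    (x := (1 + s) / 2) ⟨by linarith [hs.1], by linarith [hs.2]⟩
  rw [← hasSum_nat_add_iff' 1] at h
  have h' := (Complex.hasSum_ofReal.mpr h).tsum_eq
  convert! h' using 1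
  · refine tsum_congr fun n ↦ ?_
    have e : 2 * Real.pi * ((n + 1 : ℕ) : ℝ) * ((1 + s) / 2) =
        s * (Real.pi * (n + 1)) + ((n + 1 : ℕ) : ℝ) * Real.pi := by
      push_cast; ring
    have e' : (s : ℂ) ^ 2 * ((Real.pi : ℂ) ^ 2 * ((n : ℂ) + 1) ^ 2) =
        ((s * (Real.pi * (n + 1)) : ℝ) : ℂ) ^ 2 := by
      push_cast; ring
    rw [e, Real.cos_add_nat_mul_pi, e', cosSqrt_sq]
    push_cast
    ring
  · simp [Polynomial.bernoulli_def, Finset.sum_range_succ, Polynomial.eval_monomial,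
      bernoulli_eq_bernoulli'_of_ne_one, bernoulli_one, Nat.factorial]
    ring

theorem tsum_neg_one_pow_div_sq_mul_iteratedDeriv_cosSqrt (k : ℕ) {s : ℝ}
    (hs : s ∈ Set.Icc (0 : ℝ) 1) :
    ∑' n : ℕ, (-1 : ℂ) ^ (n + 1) / ((n : ℂ) + 1) ^ 2 *
      iteratedDeriv k cosSqrt ((s : ℂ) ^ 2 * ((Real.pi : ℂ) ^ 2 * ((n : ℂ) + 1) ^ 2)) =
    -(Real.pi : ℂ) ^ 2 * (iteratedDeriv k cosSqrt 0 / 12 +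
      (s : ℂ) ^ 2 * iteratedDeriv (k + 1) cosSqrt 0 / 2) := by
  have rec0 (j : ℕ) := iteratedDeriv_cosSqrt_recurrence j 0
  induction k generalizing s with
  | zero =>
    have h := rec0 0
    have h0 : cosSqrt 0 = 1 := by simpa using cosSqrt_sq 0
    simp only [iteratedDeriv_zero, tsum_neg_one_pow_div_sq_mul_cos hs, h0] at h ⊢
    push_cast at h
    linear_combination (Real.pi : ℂ) ^ 2 * (s : ℂ) ^ 2 / 4 * h
  | succ k ih =>
    have hsum : Summable fun n : ℕ ↦ ‖(-1 : ℂ) ^ (n + 1) / ((n : ℂ) + 1) ^ 2‖ * (1 / 2) ^ k :=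
      summable_norm_neg_one_pow_div_sq.mul_right _
    rcases eq_or_ne s 0 with rfl | hs0
    · have h := ih (s := 0) (by simp)
      simp only [Complex.ofReal_zero, ne_eq, two_ne_zero, not_false_eq_true, zero_pow, zero_mul,
        tsum_mul_right] at h ⊢
      have h1 := rec0 k
      have hk : (4 * k + 2 : ℂ) ≠ 0 := by exact_mod_cast (by omega : 4 * k + 2 ≠ 0)
      apply mul_left_cancel₀ hk
      linear_combination -h + (∑' n : ℕ, (-1 : ℂ) ^ (n + 1) / ((n : ℂ) + 1) ^ 2 +
        (Real.pi : ℂ) ^ 2 / 12) * h1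
    · set t : ℕ → ℝ → ℂ := fun n x ↦ (-1 : ℂ) ^ (n + 1) / ((n : ℂ) + 1) ^ 2 *
        ((x : ℂ) ^ (2 * k + 1) * iteratedDeriv (k + 1) cosSqrt
          ((x : ℂ) ^ 2 * ((Real.pi : ℂ) ^ 2 * ((n : ℂ) + 1) ^ 2))) with ht
      have hderiv (x : ℝ) (hx : x ∈ Set.Ioo (-2 : ℝ) 2) :=
        hasDerivAt_tsum_of_isPreconnected (𝕜 := ℝ) (g := t) (t := Set.Ioo (-2) 2) (y₀ := 0)
          (y := x) (hsum.mul_left (1 / 2 * 2 ^ (2 * k))) isOpen_Ioo isPreconnected_Ioo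
          (fun n y _ ↦ ((hasDerivAt_pow_mul_iteratedDeriv_cosSqrt k
            ((Real.pi : ℂ) ^ 2 * ((n : ℂ) + 1) ^ 2) y).comp_ofReal).const_mul _)
          (fun n y hy ↦ by
            have hy' : |y| ≤ 2 := abs_le.mpr ⟨hy.1.le, hy.2.le⟩
            rw [mul_left_comm, norm_mul]
            refine mul_le_mul ?_ (norm_neg_one_pow_div_sq_mul_iteratedDeriv_cosSqrt_le k n y)
              (norm_nonneg _) (by positivity)
            have e : ‖-(1 / 2 : ℂ)‖ = 1 / 2 := by simp
            rw [norm_mul, e, norm_pow, Complex.norm_real, Real.norm_eq_abs]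
            gcongr)
          (by norm_num) (by simp [ht, summable_zero]) hx
      let F : ℝ → ℂ := fun x ↦ (∑' n, t n x) + (Real.pi : ℂ) ^ 2 *
        ((x : ℂ) ^ (2 * k + 1) * iteratedDeriv (k + 1) cosSqrt 0 / 12 +
          (x : ℂ) ^ (2 * k + 3) * iteratedDeriv (k + 2) cosSqrt 0 / 2)
      have hF (x : ℝ) (hx : x ∈ Set.Icc (0 : ℝ) 1) : HasDerivAt F 0 x := by
        have hp (m : ℕ) := (hasDerivAt_pow m (x : ℂ)).comp_ofReal
        refine ((hderiv x ⟨by linarith [hx.1], by linarith [hx.2]⟩).add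
          (((((hp (2 * k + 1)).mul_const (iteratedDeriv (k + 1) cosSqrt 0)).div_const 12).add
          (((hp (2 * k + 3)).mul_const (iteratedDeriv (k + 2) cosSqrt 0)).div_const 2)).const_mul
          ((Real.pi : ℂ) ^ 2))).congr_deriv ?_
        simp only [mul_left_comm ((-1 : ℂ) ^ _ / _), tsum_mul_left, ih hx]
        have h1 := rec0 k
        have h2 := rec0 (k + 1)
        have e3 : 2 * k + 3 - 1 = 2 * k + 2 := by omega
        rw [e3, Nat.add_sub_cancel]
        push_cast at h1 h2 ⊢
        linear_combination (Real.pi : ℂ) ^ 2 * (x : ℂ) ^ (2 * k) * h1 / 24 +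
          (Real.pi : ℂ) ^ 2 * (x : ℂ) ^ (2 * k + 2) * h2 / 4
      have hconst := constant_of_has_deriv_right_zero
        (fun x hx ↦ (hF x hx).continuousAt.continuousWithinAt)
        (fun x hx ↦ (hF x (Set.Ico_subset_Icc_self hx)).hasDerivWithinAt) s hs
      have hF0 : F 0 = 0 := by simp [F, ht]
      rw [hF0] at hconst
      simp only [F, ht, mul_left_comm ((-1 : ℂ) ^ _ / _), tsum_mul_left] at hconst
      have hs1 : (s : ℂ) ^ (2 * k + 1) ≠ 0 := pow_ne_zero _ (by exact_mod_cast hs0)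
      apply mul_left_cancel₀ hs1
      linear_combination hconst

/-- Gosper's cosine series, for arbitrary complex `b`:
`∑_{n≥1} (-1)ⁿ/n² · cos(√(b²+π²n²)) = (π²/4)(sin(b)/b − cos(b)/3)`. -/
theorem gosper_cosine_series (b : ℂ) :
    (∑' n : ℕ, ((-1 : ℂ) ^ (n + 1) / ((n : ℂ) + 1) ^ 2) *
        cosSqrt (b ^ 2 + (Real.pi : ℂ) ^ 2 * ((n : ℂ) + 1) ^ 2)) =
      ((Real.pi : ℂ) ^ 2 / 4) * (sincSqrt (b ^ 2) - cosSqrt (b ^ 2) / 3) := by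
  have taylor (n : ℕ) := Complex.hasSum_taylorSeries_of_entire differentiable_cosSqrt
    ((Real.pi : ℂ) ^ 2 * ((n : ℂ) + 1) ^ 2) (b ^ 2 + (Real.pi : ℂ) ^ 2 * ((n : ℂ) + 1) ^ 2)
  have taylor0 := Complex.hasSum_taylorSeries_of_entire differentiable_cosSqrt 0 (b ^ 2)
  have hdiff : Differentiable ℂ (iteratedDeriv 1 cosSqrt) := fun z ↦
    (hasDerivAt_iteratedDeriv_cosSqrt 1 z).differentiableAt
  have taylor1 := Complex.hasSum_taylorSeries_of_entire hdiff 0 (b ^ 2)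
  have hit (k : ℕ) : iteratedDeriv k (iteratedDeriv 1 cosSqrt) = iteratedDeriv (k + 1) cosSqrt := by
    rw [iteratedDeriv_one, iteratedDeriv_succ']
  simp only [add_sub_cancel_right, sub_zero, smul_eq_mul, hit] at taylor taylor0 taylor1
  have hsum : Summable (Function.uncurry fun (n k : ℕ) ↦
      (-1 : ℂ) ^ (n + 1) / ((n : ℂ) + 1) ^ 2 * ((k.factorial : ℂ)⁻¹ * ((b ^ 2) ^ k *
        iteratedDeriv k cosSqrt ((Real.pi : ℂ) ^ 2 * ((n : ℂ) + 1) ^ 2)))) := by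
    refine .of_norm_bounded (summable_norm_neg_one_pow_div_sq.mul_of_nonneg
      (Real.summable_pow_div_factorial (‖b‖ ^ 2 / 2)) (fun _ ↦ norm_nonneg _)
      (fun _ ↦ by positivity)) ?_
    rintro ⟨n, k⟩
    have h := norm_neg_one_pow_div_sq_mul_iteratedDeriv_cosSqrt_le k n 1
    rw [Complex.ofReal_one, one_pow, one_mul] at h
    calc _ = ‖b‖ ^ (2 * k) / k.factorial * ‖(-1 : ℂ) ^ (n + 1) / ((n : ℂ) + 1) ^ 2 *
          iteratedDeriv k cosSqrt ((Real.pi : ℂ) ^ 2 * ((n : ℂ) + 1) ^ 2)‖ := by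
          simp only [Function.uncurry, norm_mul, norm_pow, norm_inv, Complex.norm_natCast]
          ring
      _ ≤ ‖b‖ ^ (2 * k) / k.factorial *
          (‖(-1 : ℂ) ^ (n + 1) / ((n : ℂ) + 1) ^ 2‖ * (1 / 2) ^ k) := by gcongr
      _ = _ := by
          simp only [div_pow, one_pow]
          ring
  calc _ = ∑' (n : ℕ) (k : ℕ), (-1 : ℂ) ^ (n + 1) / ((n : ℂ) + 1) ^ 2 *
        ((k.factorial : ℂ)⁻¹ * ((b ^ 2) ^ k *
          iteratedDeriv k cosSqrt ((Real.pi : ℂ) ^ 2 * ((n : ℂ) + 1) ^ 2))) :=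
        tsum_congr fun n ↦ by rw [← (taylor n).tsum_eq, tsum_mul_left]
    _ = ∑' k : ℕ, -(Real.pi : ℂ) ^ 2 * ((k.factorial : ℂ)⁻¹ * ((b ^ 2) ^ k *
          iteratedDeriv k cosSqrt 0) * (1 / 12) + (k.factorial : ℂ)⁻¹ * ((b ^ 2) ^ k *
          iteratedDeriv (k + 1) cosSqrt 0) * (1 / 2)) := by
        rw [← hsum.tsum_comm]
        refine tsum_congr fun k ↦ ?_
        have h := tsum_neg_one_pow_div_sq_mul_iteratedDeriv_cosSqrt k (s := 1) (by simp)
        simp only [Complex.ofReal_one, one_pow, one_mul] at h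
        simp only [mul_left_comm ((-1 : ℂ) ^ _ / _), tsum_mul_left, h]
        ring
    _ = _ := by
        rw [(((taylor0.mul_right _).add (taylor1.mul_right _)).mul_left _).tsum_eq,
          iteratedDeriv_one_cosSqrt_sq]
        ring
end

section
/- Abel–Plana type evaluation of the alternating Bessel-type sum: for ν real with ν > -1/2 and every b ∈ ℂ, the series ∑_{n=0}^{∞} (-1)^n/(n+1/2) · J(√(b² + π²(n+1/2)²)) converges absolutely and equals (π/2) J(b), where J(z) = ∑_{n=0}^{∞} (-1)^n z^{2n}/(2^{ν+2n} n! Γ(n+ν+1)). -/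
open Real

/-- The entire function `ζ ↦ J(√ζ)` where `J(z) = z^{-ν} J_ν(z)`, given by the
power series `∑ (-1)ⁿ ζⁿ / (2^{ν+2n} n! Γ(n+ν+1))`. -/
noncomputable def besselSqrt (ν : ℝ) (ζ : ℂ) : ℂ :=
  ∑' n : ℕ, ((-1 : ℂ) ^ n * ζ ^ n) /
    ((2 : ℂ) ^ ((ν : ℂ) + 2 * n) * (n.factorial : ℂ) * Complex.Gamma (n + ν + 1))

open MeasureTheory Set Filter Topology

/-- `(-1)ⁿ / (2^{ν+2n} Γ(n+ν+1))`, which is `n!` times the `n`-th Taylor coefficient of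
`besselSqrt ν`. -/
noncomputable def besselCoeff (ν : ℝ) (n : ℕ) : ℝ :=
  (-1) ^ n / (2 ^ (ν + 2 * n) * Real.Gamma (n + ν + 1))

theorem besselSqrt_eq_tsum (ν : ℝ) (ζ : ℂ) :
    besselSqrt ν ζ = ∑' n : ℕ, (besselCoeff ν n : ℂ) * (ζ ^ n / n.factorial) := by
  refine tsum_congr fun n => ?_
  have h2 : ((2 ^ (ν + 2 * n) : ℝ) : ℂ) = (2 : ℂ) ^ ((ν : ℂ) + 2 * n) := by
    rw [Complex.ofReal_cpow zero_le_two]; push_cast; rfl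
  have hG : ((Real.Gamma (n + ν + 1) : ℝ) : ℂ) = Complex.Gamma (n + ν + 1) := by
    rw [← Complex.Gamma_ofReal]; push_cast; rfl
  rw [besselCoeff, ← hG, ← h2]
  push_cast
  simp only [div_eq_mul_inv, mul_inv]
  ring

theorem besselCoeff_add (ν : ℝ) (n k : ℕ) :
    besselCoeff ν (n + k) = (-1 / 2) ^ k * besselCoeff (ν + k) n := by
  have h : (2 : ℝ) ^ (ν + 2 * ((n + k : ℕ) : ℝ)) = 2 ^ k * 2 ^ (ν + k + 2 * n) := by
    rw [← Real.rpow_natCast 2 k, ← Real.rpow_add two_pos]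
    push_cast
    ring_nf
  rw [besselCoeff, besselCoeff, h, div_pow]
  have h' : ((n + k : ℕ) : ℝ) + ν + 1 = n + (ν + k) + 1 := by push_cast; ring
  rw [h', pow_add]
  simp only [div_eq_mul_inv, mul_inv]
  ring

theorem besselCoeff_succ {ν : ℝ} (hν : -1 / 2 < ν) (n : ℕ) :
    besselCoeff ν (n + 1) = -besselCoeff ν n / (4 * (n + ν + 1)) := by
  have hn : (0 : ℝ) ≤ n := n.cast_nonneg
  have h : (2 : ℝ) ^ (ν + 2 * ((n + 1 : ℕ) : ℝ)) = 4 * 2 ^ (ν + 2 * n) := by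
    rw [show (4 : ℝ) = 2 ^ (2 : ℝ) by norm_num, ← Real.rpow_add two_pos]
    push_cast
    ring_nf
  have h' : ((n + 1 : ℕ) : ℝ) + ν + 1 = (n + ν + 1) + 1 := by push_cast; ring
  rw [besselCoeff, besselCoeff, h, h', Real.Gamma_add_one (by linarith), pow_succ]
  simp only [div_eq_mul_inv, mul_inv]
  ring

theorem abs_besselCoeff_le {ν : ℝ} (hν : -1 / 2 < ν) (n : ℕ) :
    |besselCoeff ν n| ≤ |besselCoeff ν 0| := by
  induction n with
  | zero => rfl
  | succ n ih =>
    have hn : (0 : ℝ) ≤ n := n.cast_nonneg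
    rw [besselCoeff_succ hν, abs_div, abs_neg]
    refine (div_le_self (abs_nonneg _) ?_).trans ih
    rw [abs_of_pos] <;> linarith

/-- Taylor expansion of `besselSqrt ν` around an arbitrary point. -/
theorem besselSqrt_add {ν : ℝ} (hν : -1 / 2 < ν) (x y : ℂ) :
    besselSqrt ν (x + y) =
      ∑' k : ℕ, (-x / 2) ^ k / k.factorial * besselSqrt (ν + k) y := by
  set f : ℕ × ℕ → ℂ := fun p => (besselCoeff ν (p.1 + p.2) : ℂ) *
    (x ^ p.1 / p.1.factorial * (y ^ p.2 / p.2.factorial)) with hf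
  have hs : Summable f := by
    have h := ((NormedSpace.norm_expSeries_div_summable (𝔸 := ℂ) x).mul_of_nonneg
      (NormedSpace.norm_expSeries_div_summable (𝔸 := ℂ) y) (fun _ => norm_nonneg _)
      (fun _ => norm_nonneg _)).mul_left |besselCoeff ν 0|
    refine Summable.of_norm_bounded h fun p => ?_
    rw [hf, norm_mul, norm_mul, Complex.norm_real, Real.norm_eq_abs]
    exact mul_le_mul_of_nonneg_right (abs_besselCoeff_le hν _) (by positivity)
  have h1 : ∑' p, f p = besselSqrt ν (x + y) := by
    have hσ : Summable fun c => f (Finset.HasAntidiagonal.sigmaAntidiagonalEquivProd c) :=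
      (Finset.HasAntidiagonal.sigmaAntidiagonalEquivProd.summable_iff (f := f)).mpr hs
    rw [besselSqrt_eq_tsum, ← Finset.HasAntidiagonal.sigmaAntidiagonalEquivProd.tsum_eq f,
      hσ.tsum_sigma' fun n => (hasSum_fintype _).summable]
    refine tsum_congr fun n => ?_
    rw [tsum_fintype, Finset.univ_eq_attach]
    simp only [Finset.HasAntidiagonal.sigmaAntidiagonalEquivProd_apply]
    rw [Finset.sum_attach (Finset.HasAntidiagonal.antidiagonal n) fun p => f p,
      (Commute.all x y).add_pow', Finset.sum_div, Finset.mul_sum]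
    refine Finset.sum_congr rfl fun p hp => ?_
    obtain rfl := Finset.HasAntidiagonal.mem_antidiagonal.mp hp
    have hc : ((p.1 + p.2).choose p.1 : ℂ) * (p.1.factorial * p.2.factorial) =
        (p.1 + p.2).factorial := by
      have h := Nat.add_choose_mul_factorial_mul_factorial p.2 p.1
      rw [add_comm p.2, mul_assoc, mul_comm p.2.factorial] at h
      exact_mod_cast h
    have h0 := Nat.factorial_ne_zero
    have h1 : ((p.1 + p.2).factorial : ℂ) ≠ 0 := by exact_mod_cast h0 _
    have h2 : (p.1.factorial : ℂ) ≠ 0 := by exact_mod_cast h0 _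
    have h3 : (p.2.factorial : ℂ) ≠ 0 := by exact_mod_cast h0 _
    simp only [hf, nsmul_eq_mul]
    congr 1
    rw [eq_div_iff h1, ← hc]
    field_simp
  rw [← h1, hs.tsum_prod]
  refine tsum_congr fun k => ?_
  rw [besselSqrt_eq_tsum, ← tsum_mul_left]
  refine tsum_congr fun m => ?_
  simp only [hf]
  rw [add_comm k m, besselCoeff_add]
  push_cast
  rw [neg_div, div_pow, neg_pow, div_pow, neg_pow 1]
  simp only [div_eq_mul_inv]
  ring

/-- A second mean value type bound, obtained by integration by parts against a monotone factor. -/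
theorem abs_integral_mul_le_of_deriv_nonneg {a b M : ℝ} {g g' F f : ℝ → ℝ} (hab : a ≤ b)
    (hg : ∀ x ∈ Icc a b, HasDerivAt g (g' x) x) (hg' : ContinuousOn g' (Icc a b))
    (hpos : ∀ x ∈ Icc a b, 0 ≤ g' x)
    (hF : ContinuousOn F (Icc a b)) (hFf : ∀ x ∈ Ioo a b, HasDerivAt F (f x) x)
    (hf : IntervalIntegrable f volume a b) (hM : ∀ x ∈ Icc a b, |F x| ≤ M) :
    |∫ x in a..b, g x * f x| ≤ M * (|g a| + |g b| + |g b - g a|) := by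
  have hgi : IntervalIntegrable g' volume a b :=
    ContinuousOn.intervalIntegrable (by rwa [uIcc_of_le hab])
  rw [intervalIntegral.integral_mul_deriv_eq_deriv_mul_of_hasDerivAt
    (u := g) (v := F) (u' := g') (v' := f)
    (fun x hx => (hg x (by rwa [uIcc_of_le hab] at hx)).continuousAt.continuousWithinAt)
    (by rwa [uIcc_of_le hab])
    (fun x hx => hg x (by
      rw [min_eq_left hab, max_eq_right hab] at hx; exact Ioo_subset_Icc_self hx))
    (fun x hx => hFf x (by rwa [min_eq_left hab, max_eq_right hab] at hx)) hgi hf]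
  have h3 : |∫ x in a..b, g' x * F x| ≤ M * |g b - g a| := by
    have : ∫ x in a..b, M * g' x = M * (g b - g a) := by
      rw [intervalIntegral.integral_const_mul, intervalIntegral.integral_eq_sub_of_hasDerivAt
        (fun x hx => hg x (by rwa [uIcc_of_le hab] at hx)) hgi]
    have hM0 : 0 ≤ M := (abs_nonneg _).trans (hM a (left_mem_Icc.mpr hab))
    refine le_trans ?_ (this.le.trans (mul_le_mul_of_nonneg_left (le_abs_self _) hM0))
    rw [← Real.norm_eq_abs]
    refine intervalIntegral.norm_integral_le_of_norm_le hab ?_ (hgi.const_mul M)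
    refine ae_of_all _ fun x hx => ?_
    have hx' := Ioc_subset_Icc_self hx
    rw [norm_mul, Real.norm_eq_abs, Real.norm_eq_abs, abs_of_nonneg (hpos x hx'), mul_comm]
    exact mul_le_mul_of_nonneg_right (hM x hx') (hpos x hx')
  have ha := mul_le_mul_of_nonneg_left (hM a (left_mem_Icc.mpr hab)) (abs_nonneg (g a))
  have hb := mul_le_mul_of_nonneg_left (hM b (right_mem_Icc.mpr hab)) (abs_nonneg (g b))
  rw [← abs_mul] at ha hb
  have h4 := abs_sub (g b * F b - g a * F a) (∫ x in a..b, g' x * F x)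
  have h5 := abs_sub (g b * F b) (g a * F a)
  linarith

theorem abs_integral_mul_le_of_deriv_nonpos {a b M : ℝ} {g g' F f : ℝ → ℝ} (hab : a ≤ b)
    (hg : ∀ x ∈ Icc a b, HasDerivAt g (g' x) x) (hg' : ContinuousOn g' (Icc a b))
    (hneg : ∀ x ∈ Icc a b, g' x ≤ 0)
    (hF : ContinuousOn F (Icc a b)) (hFf : ∀ x ∈ Ioo a b, HasDerivAt F (f x) x)
    (hf : IntervalIntegrable f volume a b) (hM : ∀ x ∈ Icc a b, |F x| ≤ M) :
    |∫ x in a..b, g x * f x| ≤ M * (|g a| + |g b| + |g b - g a|) := by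
  have h := abs_integral_mul_le_of_deriv_nonneg hab (g := fun x => -g x) (g' := fun x => -g' x)
    (fun x hx => (hg x hx).fun_neg) hg'.fun_neg (fun x hx => neg_nonneg.mpr (hneg x hx)) hF hFf hf hM
  simpa only [neg_mul, intervalIntegral.integral_neg, abs_neg, neg_sub_neg, abs_sub_comm (g a)]
    using h

/-- The weight `u^{-1/2} (1-u)^a` of Poisson's integral in the variable `u = t²`. -/
noncomputable def poissonWeight (a u : ℝ) : ℝ := u ^ (-1 / 2 : ℝ) * (1 - u) ^ a

theorem poissonWeight_nonneg (a : ℝ) {u : ℝ} (hu : u ∈ Icc (0 : ℝ) 1) : 0 ≤ poissonWeight a u :=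
  mul_nonneg (Real.rpow_nonneg hu.1 _) (Real.rpow_nonneg (sub_nonneg.mpr hu.2) _)

theorem measurable_poissonWeight (a : ℝ) : Measurable (poissonWeight a) := by
  unfold poissonWeight; fun_prop

theorem betaIntegrand_eq_ofReal (s t : ℝ) {u : ℝ} (hu : u ∈ Icc (0 : ℝ) 1) :
    (u : ℂ) ^ ((s : ℂ) - 1) * (1 - (u : ℂ)) ^ ((t : ℂ) - 1) =
      ((u ^ (s - 1) * (1 - u) ^ (t - 1) : ℝ) : ℂ) := by
  rw [Complex.ofReal_mul, Complex.ofReal_cpow hu.1, Complex.ofReal_cpow (sub_nonneg.mpr hu.2)]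
  push_cast
  rfl

theorem intervalIntegrable_rpow_mul_one_sub_rpow {s t : ℝ} (hs : 0 < s) (ht : 0 < t) :
    IntervalIntegrable (fun u : ℝ => u ^ (s - 1) * (1 - u) ^ (t - 1)) volume 0 1 := by
  have h := Complex.betaIntegral_convergent (u := s) (v := t) (by simpa) (by simpa)
  rw [intervalIntegrable_iff_integrableOn_Ioc_of_le zero_le_one] at h ⊢
  refine IntegrableOn.congr_fun (f := fun u : ℝ =>
    ((u : ℂ) ^ ((s : ℂ) - 1) * (1 - (u : ℂ)) ^ ((t : ℂ) - 1)).re) h.re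
    (fun u hu => ?_) measurableSet_Ioc
  simp only [betaIntegrand_eq_ofReal s t (Ioc_subset_Icc_self hu), Complex.ofReal_re]

theorem integral_rpow_mul_one_sub_rpow {s t : ℝ} (hs : 0 < s) (ht : 0 < t) :
    ∫ u in (0 : ℝ)..1, u ^ (s - 1) * (1 - u) ^ (t - 1) =
      Real.Gamma s * Real.Gamma t / Real.Gamma (s + t) := by
  have h := ProbabilityTheory.beta_eq_betaIntegralReal s t hs ht
  rw [ProbabilityTheory.beta] at h
  rw [h, Complex.betaIntegral, intervalIntegral.integral_congr (g := fun u : ℝ =>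
    ((u ^ (s - 1) * (1 - u) ^ (t - 1) : ℝ) : ℂ))
    fun u hu => betaIntegrand_eq_ofReal s t (by rwa [uIcc_of_le zero_le_one] at hu),
    intervalIntegral.integral_ofReal, Complex.ofReal_re]

theorem intervalIntegrable_poissonWeight {a : ℝ} (ha : -1 < a) :
    IntervalIntegrable (poissonWeight a) volume 0 1 := by
  have h := intervalIntegrable_rpow_mul_one_sub_rpow (s := 1 / 2) (t := a + 1) (by norm_num)
    (by linarith)
  convert h using 2 with u
  rw [poissonWeight]
  norm_num

theorem integral_poissonWeight_mul_pow {a : ℝ} (ha : -1 < a) (n : ℕ) :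
    ∫ u in (0 : ℝ)..1, poissonWeight a u * u ^ n =
      Real.Gamma (n + 1 / 2) * Real.Gamma (a + 1) / Real.Gamma (n + a + 3 / 2) := by
  have hn : (0 : ℝ) ≤ n := n.cast_nonneg
  have h := integral_rpow_mul_one_sub_rpow (s := n + 1 / 2) (t := a + 1) (by linarith)
    (by linarith)
  rw [show (n : ℝ) + 1 / 2 + (a + 1) = n + a + 3 / 2 by ring] at h
  rw [← h, intervalIntegral.integral_of_le zero_le_one, intervalIntegral.integral_of_le zero_le_one]
  refine setIntegral_congr_fun measurableSet_Ioc fun u hu => ?_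
  simp only [poissonWeight]
  rw [show (n : ℝ) + 1 / 2 - 1 = -1 / 2 + n by ring, Real.rpow_add hu.1, Real.rpow_natCast,
    add_sub_cancel_right]
  ring

theorem Gamma_natCast_add_half (n : ℕ) :
    Real.Gamma (n + 1 / 2) = (2 * n).factorial * √π / (4 ^ n * n.factorial) := by
  induction n with
  | zero => simpa using Real.Gamma_one_half_eq
  | succ n ih =>
    have hn : (0 : ℝ) ≤ n := n.cast_nonneg
    rw [show ((n + 1 : ℕ) : ℝ) + 1 / 2 = (n + 1 / 2) + 1 by push_cast; ring,
      Real.Gamma_add_one (by linarith), ih, show 2 * (n + 1) = 2 * n + 1 + 1 by ring]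
    simp only [Nat.factorial_succ]
    push_cast
    field_simp
    ring

/-- Poisson's integral `∫₀¹ u^{-1/2} (1-u)^a cos(z√u) du`. -/
noncomputable def poissonIntegral (a z : ℝ) : ℝ :=
  ∫ u in (0 : ℝ)..1, poissonWeight a u * Real.cos (z * √u)

theorem intervalIntegrable_poissonWeight_mul_cos {a : ℝ} (ha : -1 < a) (z : ℝ) :
    IntervalIntegrable (fun u => poissonWeight a u * Real.cos (z * √u)) volume 0 1 :=
  (intervalIntegrable_poissonWeight ha).mul_continuousOn (by fun_prop)

theorem hasSum_poissonIntegral {a : ℝ} (ha : -1 < a) (z : ℝ) :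
    HasSum (fun n : ℕ => (-1) ^ n * z ^ (2 * n) / (2 * n).factorial *
      ∫ u in (0 : ℝ)..1, poissonWeight a u * u ^ n) (poissonIntegral a z) := by
  have hw := intervalIntegrable_poissonWeight ha
  have hsum : Summable fun n : ℕ => |z| ^ (2 * n) / (2 * n).factorial :=
    (Real.summable_pow_div_factorial |z|).comp_injective
      (mul_right_injective₀ (two_ne_zero : (2 : ℕ) ≠ 0))
  simp only [← intervalIntegral.integral_const_mul]
  refine intervalIntegral.hasSum_integral_of_dominated_convergence
    (fun n u => poissonWeight a u * (|z| ^ (2 * n) / (2 * n).factorial)) (fun n => ?_)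
    (fun n => ae_of_all _ fun u hu => ?_) (ae_of_all _ fun u _ => hsum.mul_left _) ?_
    (ae_of_all _ fun u hu => ?_)
  · have := measurable_poissonWeight a
    exact Measurable.aestronglyMeasurable (by fun_prop)
  · rw [uIoc_of_le zero_le_one] at hu
    have hu' := Ioc_subset_Icc_self hu
    have h1 := poissonWeight_nonneg a hu'
    rw [norm_mul, norm_mul, norm_div, norm_mul, norm_pow, norm_neg, norm_one, one_pow, one_mul,
      norm_pow, norm_pow, Real.norm_of_nonneg h1, Real.norm_natCast, Real.norm_eq_abs, mul_comm]
    rw [Real.norm_of_nonneg hu'.1]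
    gcongr
    exact mul_le_of_le_one_right h1 (pow_le_one₀ hu'.1 hu'.2)
  · simp only [tsum_mul_left]
    exact hw.mul_const _
  · rw [uIoc_of_le zero_le_one] at hu
    convert! (Real.hasSum_cos (z * √u)).mul_left (poissonWeight a u) using 2 with n
    rw [mul_pow, pow_mul √u, Real.sq_sqrt hu.1.le]
    ring

/-- **Poisson's integral** for the normalised Bessel function. -/
theorem besselSqrt_sq {ν : ℝ} (hν : -1 / 2 < ν) (z : ℝ) :
    besselSqrt ν ((z : ℂ) ^ 2) =
      (((2 ^ ν * √π * Real.Gamma (ν + 1 / 2))⁻¹ * poissonIntegral (ν - 1 / 2) z : ℝ) : ℂ) := by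
  rw [besselSqrt_eq_tsum, ← ((hasSum_poissonIntegral (by linarith) z).mul_left _).tsum_eq,
    Complex.ofReal_tsum]
  refine tsum_congr fun n => ?_
  rw [integral_poissonWeight_mul_pow (by linarith), Gamma_natCast_add_half, besselCoeff]
  norm_cast
  have hG : Real.Gamma (ν + 1 / 2) ≠ 0 := (Real.Gamma_pos_of_pos (by linarith)).ne'
  have hn : (0 : ℝ) ≤ n := n.cast_nonneg
  have hG' : Real.Gamma (n + ν + 1) ≠ 0 := (Real.Gamma_pos_of_pos (by linarith)).ne'
  have h1 : ν - 1 / 2 + 1 = ν + 1 / 2 := by ring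
  have h2 : (n : ℝ) + (ν - 1 / 2) + 3 / 2 = n + ν + 1 := by ring
  have h4 : (2 : ℝ) ^ (ν + 2 * n) = 2 ^ ν * 4 ^ n := by
    rw [Real.rpow_add two_pos, Real.rpow_mul zero_le_two]
    norm_num
  have hpi : √π ≠ 0 := (Real.sqrt_pos.mpr Real.pi_pos).ne'
  push_cast
  rw [h1, h2, h4, ← pow_mul]
  generalize Real.Gamma (ν + 1 / 2) = G at *
  field_simp

/-- Decay of Poisson's integral, uniform in the exponent of the weight. -/
theorem abs_poissonIntegral_le {p a z : ℝ} (hp : -1 < p) (hp0 : p ≤ 0) (hpa : p ≤ a)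
    (hz : 1 ≤ z) :
    |poissonIntegral a z| ≤ (8 + 2 / (p + 1)) * z ^ (-(p + 1)) := by
  have hz0 : 0 < z := by linarith
  set s : ℝ := 1 - 1 / (2 * z) with hs
  have hε : 0 < 1 / (2 * z) := by positivity
  have hε2 : 1 / (2 * z) ≤ 1 / 2 := by
    rw [div_le_div_iff₀ (by positivity) two_pos]; linarith
  have hs0 : 0 ≤ s := by linarith
  have hs1 : s < 1 := by linarith
  have hpow : (1 / (2 * z)) ^ p ≤ 2 * z ^ (-p) := by
    rw [one_div, Real.inv_rpow (by positivity), ← Real.rpow_neg (by positivity),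
      Real.mul_rpow zero_le_two hz0.le]
    gcongr
    exact (Real.rpow_le_rpow_of_exponent_le one_le_two (by linarith : -p ≤ 1)).trans_eq
      (Real.rpow_one 2)
  have hzp : z⁻¹ * z ^ (-p) = z ^ (-(p + 1)) := by
    rw [← Real.rpow_neg_one z, ← Real.rpow_add hz0]; ring_nf
  have hwle : ∀ u ∈ Ico (0 : ℝ) 1, (1 - u) ^ a ≤ (1 - u) ^ p := fun u hu =>
    Real.rpow_le_rpow_of_exponent_ge (by linarith [hu.2]) (by linarith [hu.1]) hpa
  have ha : -1 < a := by linarith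
  have hi := intervalIntegrable_poissonWeight_mul_cos ha z
  have hsub1 : uIcc 0 s ⊆ uIcc (0 : ℝ) 1 := by
    rw [uIcc_of_le hs0, uIcc_of_le zero_le_one]; exact Icc_subset_Icc_right hs1.le
  have hsub2 : uIcc s 1 ⊆ uIcc (0 : ℝ) 1 := by
    rw [uIcc_of_le hs1.le, uIcc_of_le zero_le_one]; exact Icc_subset_Icc_left hs0
  have hhead : |∫ u in (0 : ℝ)..s, poissonWeight a u * Real.cos (z * √u)| ≤
      8 * z ^ (-(p + 1)) := by
    have heq : ∀ u, poissonWeight a u * Real.cos (z * √u) =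
        (1 - u) ^ a * (u ^ (-1 / 2 : ℝ) * Real.cos (z * √u)) := fun u => by
      rw [poissonWeight]; ring
    simp only [heq]
    set g : ℝ → ℝ := fun u => (1 - u) ^ a with hg
    have hlt : ∀ u ∈ Icc 0 s, 0 < 1 - u := fun u hu => by linarith [hu.2]
    have hgd : ∀ u ∈ Icc 0 s, HasDerivAt g (-a * (1 - u) ^ (a - 1)) u := fun u hu => by
      have h := ((hasDerivAt_id u).const_sub 1).rpow_const (p := a) (Or.inl (hlt u hu).ne')
      exact h.congr_deriv (by simp)
    have hg'c : ContinuousOn (fun u : ℝ => -a * (1 - u) ^ (a - 1)) (Icc 0 s) := fun u hu =>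
      ((continuousAt_const.sub continuousAt_id).rpow_const
        (Or.inl (hlt u hu).ne')).const_mul _ |>.continuousWithinAt
    have hF : Continuous fun u : ℝ => 2 / z * Real.sin (z * √u) := by fun_prop
    have hFd : ∀ u ∈ Ioo 0 s, HasDerivAt (fun u : ℝ => 2 / z * Real.sin (z * √u))
        (u ^ (-1 / 2 : ℝ) * Real.cos (z * √u)) u := fun u hu => by
      have h := (((Real.hasDerivAt_sqrt hu.1.ne').const_mul z).sin).const_mul (2 / z)
      refine h.congr_deriv ?_
      rw [neg_div, Real.rpow_neg hu.1.le, ← Real.sqrt_eq_rpow]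
      field_simp
    have hf : IntervalIntegrable (fun u : ℝ => u ^ (-1 / 2 : ℝ) * Real.cos (z * √u))
        volume 0 s :=
      (intervalIntegral.intervalIntegrable_rpow' (by norm_num)).mul_continuousOn (by fun_prop)
    have hM : ∀ u ∈ Icc 0 s, |2 / z * Real.sin (z * √u)| ≤ 2 / z := fun u _ => by
      rw [abs_mul, abs_of_pos (by positivity)]
      exact mul_le_of_le_one_right (by positivity) (Real.abs_sin_le_one _)
    have hbound : |∫ u in (0 : ℝ)..s, g u * (u ^ (-1 / 2 : ℝ) * Real.cos (z * √u))| ≤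
        2 / z * (|g 0| + |g s| + |g s - g 0|) := by
      rcases le_total 0 a with h0 | h0
      · refine abs_integral_mul_le_of_deriv_nonpos hs0 hgd hg'c (fun u hu => ?_)
          hF.continuousOn hFd hf hM
        exact mul_nonpos_of_nonpos_of_nonneg (by linarith) (Real.rpow_nonneg (hlt u hu).le _)
      · refine abs_integral_mul_le_of_deriv_nonneg hs0 hgd hg'c (fun u hu => ?_)
          hF.continuousOn hFd hf hM
        exact mul_nonneg (by linarith) (Real.rpow_nonneg (hlt u hu).le _)
    have hg0 : g 0 = 1 := by simp [hg]
    have hgs0 : 0 ≤ g s := Real.rpow_nonneg (by linarith) _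
    have hgs : g s ≤ 2 * z ^ (-p) := by
      refine (hwle s ⟨hs0, hs1⟩).trans (le_trans (le_of_eq ?_) hpow)
      rw [hs]; ring_nf
    have hz1 : 1 ≤ 2 * z ^ (-p) := by
      have := Real.one_le_rpow hz (by linarith : 0 ≤ -p)
      linarith
    refine hbound.trans ?_
    rw [← hzp]
    have h3 : |g 0| + |g s| + |g s - g 0| ≤ 4 * z ^ (-p) := by
      rw [hg0, abs_one, abs_of_nonneg hgs0]
      rcases abs_cases (g s - 1) with h | h <;> linarith
    calc 2 / z * (|g 0| + |g s| + |g s - g 0|) ≤ 2 / z * (4 * z ^ (-p)) := by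
          gcongr
      _ = 8 * (z⁻¹ * z ^ (-p)) := by ring
  have htail : |∫ u in s..1, poissonWeight a u * Real.cos (z * √u)| ≤
      2 / (p + 1) * z ^ (-(p + 1)) := by
    have hint : ∫ u in s..1, 2 * (1 - u) ^ p = 2 * ((1 / (2 * z)) ^ (p + 1) / (p + 1)) := by
      rw [intervalIntegral.integral_const_mul,
        intervalIntegral.integral_comp_sub_left (fun x : ℝ => x ^ p) 1,
        integral_rpow (Or.inl hp), sub_self, Real.zero_rpow (by linarith), sub_zero, hs,
        sub_sub_cancel]
    have hi' : IntervalIntegrable (fun u : ℝ => 2 * (1 - u) ^ p) volume s 1 := by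
      have := (intervalIntegral.intervalIntegrable_rpow' (a := 1 - s) (b := 0) hp).comp_sub_left 1
      simpa using this.const_mul 2
    have h1 : |∫ u in s..1, poissonWeight a u * Real.cos (z * √u)| ≤
        2 * ((1 / (2 * z)) ^ (p + 1) / (p + 1)) := by
      rw [← hint, ← Real.norm_eq_abs]
      refine intervalIntegral.norm_integral_le_of_norm_le hs1.le ?_ hi'
      refine (measure_eq_zero_iff_ae_notMem.mp (measure_singleton (1 : ℝ))).mono fun u hu1 hu => ?_
      have hu' : u ∈ Ico (0 : ℝ) 1 := ⟨by linarith [hu.1], lt_of_le_of_ne hu.2 hu1⟩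
      have hu2 : u ^ (-1 / 2 : ℝ) ≤ 2 := by
        have h4 : (1 / 4 : ℝ) ^ (-1 / 2 : ℝ) = 2 := by
          rw [show (1 / 4 : ℝ) = 2 ^ (-2 : ℝ) by norm_num, ← Real.rpow_mul zero_le_two]
          norm_num
        refine le_trans ?_ h4.le
        exact Real.rpow_le_rpow_of_nonpos (by norm_num : (0 : ℝ) < 1 / 4) (by linarith [hu.1])
          (by norm_num)
      have h0 : 0 ≤ (1 - u) ^ a := Real.rpow_nonneg (by linarith [hu'.2]) _
      rw [norm_mul, Real.norm_of_nonneg (poissonWeight_nonneg a (Ico_subset_Icc_self hu')),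
        Real.norm_eq_abs]
      refine (mul_le_of_le_one_right (poissonWeight_nonneg a (Ico_subset_Icc_self hu'))
        (Real.abs_cos_le_one _)).trans ?_
      exact mul_le_mul hu2 (hwle u hu') h0 zero_le_two
    refine h1.trans ?_
    have h2 : (1 / (2 * z)) ^ (p + 1) ≤ z ^ (-(p + 1)) := by
      rw [Real.rpow_neg hz0.le, ← Real.inv_rpow hz0.le]
      refine Real.rpow_le_rpow hε.le ?_ (by linarith)
      rw [one_div]
      exact inv_anti₀ hz0 (by linarith)
    have hp1 : 0 < p + 1 := by linarith
    calc 2 * ((1 / (2 * z)) ^ (p + 1) / (p + 1)) ≤ 2 * (z ^ (-(p + 1)) / (p + 1)) := by gcongr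
      _ = _ := by ring
  rw [poissonIntegral, ← intervalIntegral.integral_add_adjacent_intervals
    (hi.mono_set hsub1) (hi.mono_set hsub2)]
  refine (abs_add_le _ _).trans ?_
  linarith

theorem two_mul_cos_mul_sum_sin (x : ℝ) (N : ℕ) :
    2 * Real.cos (x / 2) * ∑ n ∈ Finset.range N, (-1) ^ n * Real.sin ((n + 1 / 2) * x) =
      -(-1) ^ N * Real.sin (N * x) := by
  induction N with
  | zero => simp
  | succ N ih =>
    rw [Finset.sum_range_succ, mul_add, ih]
    have h1 : ((N + 1 : ℕ) : ℝ) * x = (N + 1 / 2) * x + x / 2 := by push_cast; ring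
    have h2 : (N : ℝ) * x = (N + 1 / 2) * x - x / 2 := by ring
    rw [h1, h2, Real.sin_add, Real.sin_sub]
    ring

/-- Partial sums of the Fourier series of a square wave of height `π / 2`. -/
noncomputable def squareWaveSum (N : ℕ) (t : ℝ) : ℝ :=
  ∑ n ∈ Finset.range N, (-1) ^ n / ((n : ℝ) + 1 / 2) * Real.cos (π * (n + 1 / 2) * t)

theorem tendsto_squareWaveSum_zero :
    Tendsto (fun N => squareWaveSum N 0) atTop (𝓝 (π / 2)) := by
  have h := Real.tendsto_sum_pi_div_four.const_mul 2
  convert h using 2 with N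
  · rw [squareWaveSum, Finset.mul_sum]
    refine Finset.sum_congr rfl fun n _ => ?_
    rw [mul_zero, Real.cos_zero]
    field_simp
  · ring

theorem one_sub_le_cos {t : ℝ} (ht : t ∈ Icc (0 : ℝ) 1) : 1 - t ≤ Real.cos (π * t / 2) := by
  have h := Real.mul_le_sin (x := π / 2 - π * t / 2) (by nlinarith [Real.pi_pos, ht.2])
    (by nlinarith [Real.pi_pos, ht.1])
  rw [Real.sin_pi_div_two_sub] at h
  refine le_trans (le_of_eq ?_) h
  field_simp

theorem hasDerivAt_squareWaveSum (N : ℕ) {t : ℝ} (ht : t ∈ Ico (0 : ℝ) 1) :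
    HasDerivAt (squareWaveSum N)
      ((-1) ^ N * (π / 2) * ((Real.cos (π * t / 2))⁻¹ * Real.sin (N * π * t))) t := by
  have hc : 0 < Real.cos (π * t / 2) :=
    (sub_pos.mpr ht.2).trans_le (one_sub_le_cos (Ico_subset_Icc_self ht))
  have h : HasDerivAt (squareWaveSum N) (∑ n ∈ Finset.range N, (-1) ^ n / ((n : ℝ) + 1 / 2) *
      (-Real.sin (π * (n + 1 / 2) * t) * (π * (n + 1 / 2) * 1))) t := by
    unfold squareWaveSum
    exact HasDerivAt.fun_sum fun n _ =>
      (((hasDerivAt_id t).const_mul (π * ((n : ℝ) + 1 / 2))).cos).const_mul _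
  refine h.congr_deriv ?_
  have hs := two_mul_cos_mul_sum_sin (π * t) N
  have hsum : ∑ n ∈ Finset.range N, (-1) ^ n / ((n : ℝ) + 1 / 2) *
      (-Real.sin (π * (n + 1 / 2) * t) * (π * (n + 1 / 2) * 1)) =
      -π * ∑ n ∈ Finset.range N, (-1) ^ n * Real.sin ((n + 1 / 2) * (π * t)) := by
    rw [Finset.mul_sum]
    refine Finset.sum_congr rfl fun n _ => ?_
    rw [show π * ((n : ℝ) + 1 / 2) * t = (n + 1 / 2) * (π * t) by ring]
    have : (n : ℝ) + 1 / 2 ≠ 0 := by positivity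
    field_simp
  rw [hsum, show (N : ℝ) * π * t = N * (π * t) by ring]
  generalize ∑ n ∈ Finset.range N, (-1) ^ n * Real.sin ((n + 1 / 2) * (π * t)) = S at *
  rw [mul_left_comm, inv_mul_eq_div, eq_div_iff hc.ne']
  linear_combination (-π / 2) * hs

theorem squareWaveSum_eq (N : ℕ) {t : ℝ} (ht : t ∈ Ico (0 : ℝ) 1) :
    squareWaveSum N t = squareWaveSum N 0 + (-1) ^ N * (π / 2) *
      ∫ x in (0 : ℝ)..t, (Real.cos (π * x / 2))⁻¹ * Real.sin (N * π * x) := by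
  have hI : ∀ x ∈ uIcc 0 t, x ∈ Ico (0 : ℝ) 1 := fun x hx => by
    rw [uIcc_of_le ht.1] at hx; exact ⟨hx.1, hx.2.trans_lt ht.2⟩
  have hc : ContinuousOn (fun x => (-1) ^ N * (π / 2) *
      ((Real.cos (π * x / 2))⁻¹ * Real.sin (N * π * x))) (uIcc 0 t) := by
    refine continuousOn_const.mul (ContinuousOn.mul (ContinuousOn.inv₀ (by fun_prop) ?_)
      (by fun_prop))
    exact fun x hx => ((sub_pos.mpr (hI x hx).2).trans_le
      (one_sub_le_cos (Ico_subset_Icc_self (hI x hx)))).ne'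
  rw [← intervalIntegral.integral_const_mul, intervalIntegral.integral_eq_sub_of_hasDerivAt
    (fun x hx => hasDerivAt_squareWaveSum N (hI x hx)) hc.intervalIntegrable]
  ring

theorem tendsto_squareWaveSum {t : ℝ} (ht : t ∈ Ico (0 : ℝ) 1) :
    Tendsto (fun N => squareWaveSum N t) atTop (𝓝 (π / 2)) := by
  set g : ℝ → ℝ := fun x => (Real.cos (π * x / 2))⁻¹ with hg
  set C := |g 0| + |g t| + |g t - g 0|
  have hpos : ∀ x ∈ Icc 0 t, 0 < Real.cos (π * x / 2) := fun x hx =>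
    (by linarith [hx.2, ht.2] : 0 < 1 - x).trans_le
      (one_sub_le_cos ⟨hx.1, hx.2.trans ht.2.le⟩)
  have hbound : ∀ N : ℕ, |∫ x in (0 : ℝ)..t, g x * Real.sin (N * π * x)| ≤ 1 / π * C / N := by
    intro N
    rcases N.eq_zero_or_pos with rfl | hN
    · simp
    have hN' : (0 : ℝ) < N := by exact_mod_cast hN
    have h := abs_integral_mul_le_of_deriv_nonneg (M := 1 / (N * π)) ht.1 (g := g)
      (g' := fun x => Real.sin (π * x / 2) * (π / 2) / Real.cos (π * x / 2) ^ 2)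
      (F := fun x => -(1 / (N * π)) * Real.cos (N * π * x)) (f := fun x => Real.sin (N * π * x))
      (fun x hx => ?_) ?_ (fun x hx => ?_) (by fun_prop) (fun x _ => ?_)
      (Continuous.intervalIntegrable (by fun_prop) _ _) (fun x _ => ?_)
    · exact h.trans_eq (by ring)
    · have h1 : HasDerivAt (fun x : ℝ => π * x / 2) (π * 1 / 2) x :=
        ((hasDerivAt_id x).const_mul π).div_const 2
      exact (h1.cos.fun_inv (hpos x hx).ne').congr_deriv (by ring)
    · exact ContinuousOn.div (by fun_prop) (by fun_prop) fun x hx => (pow_pos (hpos x hx) 2).ne'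
    · have h1 : 0 ≤ Real.sin (π * x / 2) := by
        have hx1 : x ≤ 1 := hx.2.trans ht.2.le
        have := hx.1
        refine Real.sin_nonneg_of_nonneg_of_le_pi (by positivity) ?_
        nlinarith [Real.pi_pos]
      positivity
    · have h1 : HasDerivAt (fun x : ℝ => N * π * x) (N * π * 1) x :=
        (hasDerivAt_id x).const_mul _
      refine (h1.cos.const_mul (-(1 / (N * π)))).congr_deriv ?_
      field_simp
    · rw [abs_mul, abs_neg, abs_of_pos (by positivity)]
      exact mul_le_of_le_one_right (by positivity) (Real.abs_cos_le_one _)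
  have hint : Tendsto (fun N : ℕ => (-1) ^ N * (π / 2) *
      ∫ x in (0 : ℝ)..t, g x * Real.sin (N * π * x)) atTop (𝓝 0) := by
    have h0 := (tendsto_const_div_atTop_nhds_zero_nat (1 / π * C)).const_mul (π / 2)
    rw [mul_zero] at h0
    refine squeeze_zero_norm (fun N => ?_) h0
    rw [norm_mul, norm_mul, norm_pow, norm_neg, norm_one, one_pow, one_mul,
      Real.norm_of_nonneg (by positivity), Real.norm_eq_abs]
    gcongr
    exact hbound N
  simpa [squareWaveSum_eq _ ht] using tendsto_squareWaveSum_zero.add hint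

/-- The partial sums grow at most like a small negative power of `1 - t`, uniformly in `N`. -/
theorem exists_abs_squareWaveSum_le : ∃ C, ∀ δ : ℝ, 0 < δ → ∀ N, ∀ t ∈ Ico (0 : ℝ) 1,
    |squareWaveSum N t| ≤ C + π / 2 * ((1 - t) ^ (-δ) / δ) := by
  obtain ⟨C, hC⟩ := (Metric.isBounded_range_of_tendsto _ tendsto_squareWaveSum_zero).exists_norm_le
  refine ⟨C, fun δ hδ N t ht => ?_⟩
  have hlt : ∀ x ∈ Icc 0 t, 0 < 1 - x := fun x hx => by linarith [hx.2, ht.2]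
  have hd : ∀ x ∈ uIcc 0 t, HasDerivAt (fun x : ℝ => (1 - x) ^ (-δ) / δ)
      ((1 - x) ^ (-δ - 1)) x := fun x hx => by
    rw [uIcc_of_le ht.1] at hx
    have h := (((hasDerivAt_id x).const_sub 1).rpow_const (p := -δ)
      (Or.inl (hlt x hx).ne')).div_const δ
    refine h.congr_deriv ?_
    simp only [id]
    field_simp
  have hi : IntervalIntegrable (fun x : ℝ => (1 - x) ^ (-δ - 1)) volume 0 t := by
    refine ContinuousOn.intervalIntegrable fun x hx => ?_
    rw [uIcc_of_le ht.1] at hx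
    exact ((continuousAt_const.sub continuousAt_id).rpow_const
      (Or.inl (hlt x hx).ne')).continuousWithinAt
  have hle : |∫ x in (0 : ℝ)..t, (Real.cos (π * x / 2))⁻¹ * Real.sin (N * π * x)| ≤
      (1 - t) ^ (-δ) / δ := by
    have h1 : ∫ x in (0 : ℝ)..t, (1 - x) ^ (-δ - 1) ≤ (1 - t) ^ (-δ) / δ := by
      rw [intervalIntegral.integral_eq_sub_of_hasDerivAt hd hi]
      exact sub_le_self _ (by simp [hδ.le])
    refine le_trans ?_ h1
    rw [← Real.norm_eq_abs]
    refine intervalIntegral.norm_integral_le_of_norm_le ht.1 (ae_of_all _ fun x hx => ?_) hi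
    have hx' := Ioc_subset_Icc_self hx
    have hx1 := hlt x hx'
    have hcos := one_sub_le_cos ⟨hx'.1, hx'.2.trans ht.2.le⟩
    rw [norm_mul, norm_inv, Real.norm_of_nonneg (hx1.le.trans hcos), Real.norm_eq_abs]
    refine (mul_le_of_le_one_right (inv_nonneg.mpr (hx1.le.trans hcos))
      (Real.abs_sin_le_one _)).trans ((inv_anti₀ hx1 hcos).trans ?_)
    rw [← Real.rpow_neg_one]
    exact Real.rpow_le_rpow_of_exponent_ge hx1 (by linarith [hx'.1]) (by linarith)
  rw [squareWaveSum_eq N ht]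
  refine (abs_add_le _ _).trans (add_le_add (hC _ (mem_range_self N)) ?_)
  rw [abs_mul, abs_mul, abs_pow, abs_neg, abs_one, one_pow, one_mul, abs_of_pos (by positivity)]
  gcongr

theorem tendsto_sum_poissonIntegral {a : ℝ} (ha : -1 < a) :
    Tendsto (fun N => ∑ n ∈ Finset.range N,
      (-1) ^ n / ((n : ℝ) + 1 / 2) * poissonIntegral a (π * (n + 1 / 2))) atTop
      (𝓝 (π / 2 * poissonIntegral a 0)) := by
  obtain ⟨C, hC⟩ := exists_abs_squareWaveSum_le
  set δ := (a + 1) / 2 with hδ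
  have hδ0 : 0 < δ := by linarith
  have hsum : ∀ N, ∑ n ∈ Finset.range N,
      (-1) ^ n / ((n : ℝ) + 1 / 2) * poissonIntegral a (π * (n + 1 / 2)) =
      ∫ u in (0 : ℝ)..1, poissonWeight a u * squareWaveSum N √u := by
    intro N
    simp only [poissonIntegral, ← intervalIntegral.integral_const_mul]
    rw [← intervalIntegral.integral_finsetSum fun n _ =>
      (intervalIntegrable_poissonWeight_mul_cos ha _).const_mul _]
    refine intervalIntegral.integral_congr fun u _ => ?_
    simp only [squareWaveSum, Finset.mul_sum]
    exact Finset.sum_congr rfl fun n _ => by ring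
  have hlim : π / 2 * poissonIntegral a 0 =
      ∫ u in (0 : ℝ)..1, poissonWeight a u * (π / 2) := by
    rw [poissonIntegral, intervalIntegral.integral_mul_const, mul_comm]
    simp
  simp only [hsum, hlim]
  have hmem : ∀ᵐ u : ℝ, u ∈ uIoc (0 : ℝ) 1 → u ∈ Ioo (0 : ℝ) 1 := by
    refine (measure_eq_zero_iff_ae_notMem.mp (measure_singleton (1 : ℝ))).mono fun u hu1 hu => ?_
    rw [uIoc_of_le zero_le_one] at hu
    exact ⟨hu.1, lt_of_le_of_ne hu.2 hu1⟩
  have hsqrt : ∀ u ∈ Ioo (0 : ℝ) 1, √u ∈ Ico (0 : ℝ) 1 := fun u hu =>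
    ⟨Real.sqrt_nonneg u, by rw [Real.sqrt_lt' one_pos, one_pow]; exact hu.2⟩
  refine intervalIntegral.tendsto_integral_filter_of_dominated_convergence
    (fun u => C * poissonWeight a u + π / 2 * (2 ^ δ / δ) * poissonWeight (a - δ) u)
    (Eventually.of_forall fun N => ?_) (Eventually.of_forall fun N => ?_)
    (((intervalIntegrable_poissonWeight ha).const_mul _).add
      ((intervalIntegrable_poissonWeight (by linarith)).const_mul _)) ?_
  · have := measurable_poissonWeight a
    unfold squareWaveSum
    exact Measurable.aestronglyMeasurable (by fun_prop)
  · refine hmem.mono fun u h hu => ?_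
    have hu := h hu
    have hw := poissonWeight_nonneg a (Ioo_subset_Icc_self hu)
    have h1u : 0 < 1 - u := sub_pos.mpr hu.2
    have hs := hsqrt u hu
    have hsq : (1 - u) / 2 ≤ 1 - √u := by
      have := Real.sq_sqrt hu.1.le
      nlinarith [sq_nonneg (1 - √u)]
    have hpow : (1 - √u) ^ (-δ) ≤ 2 ^ δ * (1 - u) ^ (-δ) := by
      refine (Real.rpow_le_rpow_of_nonpos (by linarith) hsq (by linarith)).trans_eq ?_
      rw [Real.div_rpow h1u.le zero_le_two, Real.rpow_neg zero_le_two, div_inv_eq_mul, mul_comm]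
    have hwδ : poissonWeight (a - δ) u = poissonWeight a u * (1 - u) ^ (-δ) := by
      rw [poissonWeight, poissonWeight, sub_eq_add_neg a, Real.rpow_add h1u, mul_assoc]
    rw [norm_mul, Real.norm_of_nonneg hw, Real.norm_eq_abs, hwδ]
    calc poissonWeight a u * |squareWaveSum N √u|
        ≤ poissonWeight a u * (C + π / 2 * ((2 ^ δ * (1 - u) ^ (-δ)) / δ)) := by
          refine mul_le_mul_of_nonneg_left ((hC δ hδ0 N _ hs).trans ?_) hw
          gcongr
      _ = _ := by ring
  · exact hmem.mono fun u h hu => (tendsto_squareWaveSum (hsqrt u (h hu))).const_mul _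

/-- The normalising constant in Poisson's integral grows at most geometrically in the order. -/
theorem poissonConst_add_le {ν : ℝ} (hν : -1 / 2 < ν) (k : ℕ) :
    (2 ^ (ν + k) * √π * Real.Gamma (ν + k + 1 / 2))⁻¹ ≤
      (2 ^ ν * √π * Real.Gamma (ν + 1 / 2))⁻¹ * ((2 * (ν + 1 / 2))⁻¹) ^ k := by
  have hν' : 0 < ν + 1 / 2 := by linarith
  induction k with
  | zero => simp
  | succ k ih =>
    have hk : (0 : ℝ) ≤ k := k.cast_nonneg
    have h1 : (2 : ℝ) ^ (ν + (k + 1 : ℕ)) = 2 ^ (ν + k) * 2 := by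
      push_cast
      rw [← add_assoc, Real.rpow_add_one two_ne_zero]
    have h2 : Real.Gamma (ν + (k + 1 : ℕ) + 1 / 2) =
        (ν + k + 1 / 2) * Real.Gamma (ν + k + 1 / 2) := by
      rw [← Real.Gamma_add_one (by linarith)]
      push_cast
      ring_nf
    have hG : 0 < Real.Gamma (ν + k + 1 / 2) := Real.Gamma_pos_of_pos (by linarith)
    rw [h1, h2]
    calc (2 ^ (ν + k) * 2 * √π * ((ν + k + 1 / 2) * Real.Gamma (ν + k + 1 / 2)))⁻¹
        = (2 ^ (ν + k) * √π * Real.Gamma (ν + k + 1 / 2))⁻¹ * (2 * (ν + k + 1 / 2))⁻¹ := by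
          rw [← mul_inv]; ring_nf
      _ ≤ (2 ^ ν * √π * Real.Gamma (ν + 1 / 2))⁻¹ * ((2 * (ν + 1 / 2))⁻¹) ^ k *
          (2 * (ν + 1 / 2))⁻¹ := by
        refine mul_le_mul ih (inv_anti₀ (by linarith) (by linarith)) ?_
          (le_trans (by positivity) ih)
        exact inv_nonneg.mpr (by linarith)
      _ = _ := by rw [pow_succ, mul_assoc]

theorem summable_gosper_double {ν : ℝ} (hν : -1 / 2 < ν) (x : ℂ) :
    Summable fun p : ℕ × ℕ => (-1 : ℂ) ^ p.1 / ((p.1 : ℂ) + 1 / 2) *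
      ((-x / 2) ^ p.2 / p.2.factorial *
        besselSqrt (ν + p.2) (((π * (p.1 + 1 / 2) : ℝ) : ℂ) ^ 2)) := by
  set p := min (ν - 1 / 2) 0
  have hp : -1 < p := lt_min (by linarith) (by norm_num)
  have hp0 : p ≤ 0 := min_le_right _ _
  have hpν : p ≤ ν - 1 / 2 := min_le_left _ _
  set K := (2 ^ ν * √π * Real.Gamma (ν + 1 / 2))⁻¹ * (8 + 2 / (p + 1)) with hK
  set M := (2 * (ν + 1 / 2))⁻¹ with hM
  have hM0 : 0 ≤ M := inv_nonneg.mpr (by linarith)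
  have hG : 0 < Real.Gamma (ν + 1 / 2) := Real.Gamma_pos_of_pos (by linarith)
  have h1 : Summable fun n : ℕ => 1 / ((n : ℝ) + 1 / 2) * (π * (n + 1 / 2)) ^ (-(p + 1)) := by
    have h0 := (Real.summable_one_div_nat_add_rpow (1 / 2) (p + 2)).mpr (by linarith)
    refine (h0.mul_left (π ^ (-(p + 1)))).congr fun n => ?_
    have hn : 0 < (n : ℝ) + 1 / 2 := by positivity
    rw [Real.mul_rpow Real.pi_pos.le hn.le, abs_of_pos hn]
    generalize (n : ℝ) + 1 / 2 = y at hn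
    rw [one_div, one_div,
      ← Real.rpow_neg hn.le, ← Real.rpow_neg_one, mul_left_comm, ← Real.rpow_add hn]
    ring_nf
  have h2 : Summable fun k : ℕ => (‖x‖ / 2 * M) ^ k / k.factorial :=
    Real.summable_pow_div_factorial _
  refine Summable.of_norm_bounded ((h1.mul_of_nonneg h2 (fun n => by positivity)
    (fun k => by positivity)).mul_left K) fun ⟨n, k⟩ => ?_
  have hz : 1 ≤ π * ((n : ℝ) + 1 / 2) := by
    nlinarith [Real.pi_gt_three, (n.cast_nonneg : (0 : ℝ) ≤ n)]
  have hk : (0 : ℝ) ≤ k := k.cast_nonneg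
  have hGk : 0 < Real.Gamma (ν + k + 1 / 2) := Real.Gamma_pos_of_pos (by linarith)
  have hI := abs_poissonIntegral_le (a := ν + k - 1 / 2) hp hp0 (by linarith) hz
  have hJ : ‖besselSqrt (ν + k) (((π * (n + 1 / 2) : ℝ) : ℂ) ^ 2)‖ ≤
      K * M ^ k * (π * (n + 1 / 2)) ^ (-(p + 1)) := by
    rw [besselSqrt_sq (by linarith), Complex.norm_real, Real.norm_eq_abs, abs_mul,
      abs_of_pos (by positivity)]
    refine (mul_le_mul (poissonConst_add_le hν k) hI (abs_nonneg _) (by positivity)).trans_eq ?_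
    rw [hK]
    ring
  have hn : ‖(-1 : ℂ) ^ n / ((n : ℂ) + 1 / 2)‖ = 1 / ((n : ℝ) + 1 / 2) := by
    have : ((n : ℂ) + 1 / 2) = (((n : ℝ) + 1 / 2 : ℝ) : ℂ) := by push_cast; rfl
    rw [norm_div, norm_pow, norm_neg, norm_one, one_pow, this, Complex.norm_real,
      Real.norm_of_nonneg (by positivity)]
  rw [norm_mul, hn, norm_mul, norm_div, norm_pow, norm_div, norm_neg, Complex.norm_natCast,
    Complex.norm_two]
  calc 1 / ((n : ℝ) + 1 / 2) * ((‖x‖ / 2) ^ k / k.factorial *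
        ‖besselSqrt (ν + k) (((π * (n + 1 / 2) : ℝ) : ℂ) ^ 2)‖)
      ≤ 1 / ((n : ℝ) + 1 / 2) * ((‖x‖ / 2) ^ k / k.factorial *
        (K * M ^ k * (π * (n + 1 / 2)) ^ (-(p + 1)))) := by gcongr
    _ = _ := by
      rw [mul_pow]
      ring

/-- The case `b = 0` of the summation formula. -/
theorem tsum_besselSqrt_sq {ν : ℝ} (hν : -1 / 2 < ν) :
    ∑' n : ℕ, (-1 : ℂ) ^ n / ((n : ℂ) + 1 / 2) *
      besselSqrt ν (((π * (n + 1 / 2) : ℝ) : ℂ) ^ 2) = (π : ℂ) / 2 * besselSqrt ν 0 := by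
  have hs : Summable fun n : ℕ => (-1 : ℂ) ^ n / ((n : ℂ) + 1 / 2) *
      besselSqrt ν (((π * (n + 1 / 2) : ℝ) : ℂ) ^ 2) := by
    have h := (summable_gosper_double hν 0).comp_injective (Prod.mk_left_injective 0)
    refine h.congr fun n => ?_
    simp only [Function.comp_apply, pow_zero, Nat.factorial_zero, Nat.cast_one, Nat.cast_zero,
      add_zero, div_one, one_mul]
  refine tendsto_nhds_unique hs.hasSum.tendsto_sum_nat ?_
  have h := (tendsto_sum_poissonIntegral (a := ν - 1 / 2) (by linarith)).const_mul
    (2 ^ ν * √π * Real.Gamma (ν + 1 / 2))⁻¹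
  have h0 := besselSqrt_sq hν 0
  rw [Complex.ofReal_zero, zero_pow two_ne_zero] at h0
  convert (Complex.continuous_ofReal.tendsto _).comp h using 2 with N
  · simp only [Function.comp_apply, Finset.mul_sum, Complex.ofReal_sum]
    refine Finset.sum_congr rfl fun n _ => ?_
    rw [besselSqrt_sq hν]
    push_cast
    ring
  · rw [h0]
    push_cast
    ring

/-- Abel–Plana type evaluation of the alternating Bessel-type sum: for `ν > -1/2`
and every `b ∈ ℂ`, the series `∑ (-1)ⁿ/(n+1/2) · J(√(b²+π²(n+1/2)²))` converges
absolutely and equals `(π/2) J(b)`. -/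
theorem gosper_bessel_series (ν : ℝ) (hν : -1/2 < ν) (b : ℂ) :
    Summable (fun n : ℕ =>
      ‖((-1 : ℂ) ^ n / ((n : ℂ) + 1/2)) *
        besselSqrt ν (b ^ 2 + (Real.pi : ℂ) ^ 2 * ((n : ℂ) + 1/2) ^ 2)‖) ∧
    (∑' n : ℕ, ((-1 : ℂ) ^ n / ((n : ℂ) + 1/2)) *
        besselSqrt ν (b ^ 2 + (Real.pi : ℂ) ^ 2 * ((n : ℂ) + 1/2) ^ 2)) =
      ((Real.pi : ℂ) / 2) * besselSqrt ν (b ^ 2) := by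
  obtain ⟨f, hf⟩ : ∃ f : ℕ → ℕ → ℂ, ∀ n k, f n k = (-1 : ℂ) ^ n / ((n : ℂ) + 1 / 2) *
      ((-b ^ 2 / 2) ^ k / k.factorial *
        besselSqrt (ν + k) (((π * (n + 1 / 2) : ℝ) : ℂ) ^ 2)) := ⟨_, fun _ _ => rfl⟩
  have hs : Summable (Function.uncurry f) :=
    (summable_gosper_double hν (b ^ 2)).congr fun p => (hf p.1 p.2).symm
  have hterm : (fun n : ℕ => (-1 : ℂ) ^ n / ((n : ℂ) + 1 / 2) *
      besselSqrt ν (b ^ 2 + (π : ℂ) ^ 2 * ((n : ℂ) + 1 / 2) ^ 2)) =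
      fun n => ∑' k, f n k := funext fun n => by
    have hz : (π : ℂ) ^ 2 * ((n : ℂ) + 1 / 2) ^ 2 = ((π * (n + 1 / 2) : ℝ) : ℂ) ^ 2 := by
      push_cast
      ring
    simp only [hf]
    rw [hz, besselSqrt_add hν, tsum_mul_left]
  have hcol : ∀ k : ℕ, ∑' n, f n k =
      (π : ℂ) / 2 * ((-b ^ 2 / 2) ^ k / k.factorial * besselSqrt (ν + k) 0) := fun k => by
    have hk : -1 / 2 < ν + k := by linarith [(k.cast_nonneg : (0 : ℝ) ≤ k)]
    rw [mul_left_comm, ← tsum_besselSqrt_sq hk, ← tsum_mul_left]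
    exact tsum_congr fun n => (hf n k).trans (mul_left_comm _ _ _)
  have hsum : Summable fun n => ∑' k, f n k := hs.prod
  constructor
  · rw [← hterm] at hsum
    exact hsum.norm
  · rw [hterm, ← hs.tsum_comm]
    simp only [hcol]
    rw [tsum_mul_left, ← besselSqrt_add hν, add_zero]
end
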